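/- arXiv:2303.07571 — 8 statements merged into one kernel-verified Lean document; each statement's English description precedes it below -/
import Mathlib

section
/- Let m : ℝ → [-∞,∞] be a right-continuous, nondecreasing, non-constant function, and set m(∞) := lim_{x→∞} m(x), m(-∞) := lim_{x→-∞} m(x). Define l₀ := inf{x ∈ ℝ : m(x) > -∞}, r₀ := sup{x ∈ ℝ : m(x) < ∞}, l := inf{x > l₀ : m(x) > m(l₀)}, r := sup{x < r₀ : m(x) < m(r₀-)} (where m(r₀-) is the left limit of m at r₀), and assume l < r. Let E_m := {x ∈ [l,r] ∩ (l₀,r₀) : m(x-ε) < m(x+ε) for every ε > 0}. Then E_m is a nearly closed subset of ℝ ended by l and r; that is, E_m ⊆ ℝ, inf E_m = l, sup E_m = r, and E_m ∪ {l,r} is a closed subset of the extended reals [-∞,∞]. -/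
/-- A monotone function taking different values at `u` and `v` has a point of increase in `[u, v]`. -/
theorem Monotone.exists_point_of_increase {α : Type*} [LinearOrder α] {m : ℝ → α}
    (hm : Monotone m) {u v : ℝ} (huv : m u < m v) :
    ∃ x, u ≤ x ∧ x ≤ v ∧ ∀ ε : ℝ, 0 < ε → m (x - ε) < m (x + ε) := by
  have hlt : u < v := hm.reflect_lt huv
  set S : Set ℝ := {t | t ≤ v ∧ m t ≤ m u} with hS
  have huS : u ∈ S := ⟨hlt.le, le_rfl⟩
  have hbdd : BddAbove S := ⟨v, fun t ht => ht.1⟩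
  refine ⟨sSup S, le_csSup hbdd huS, csSup_le ⟨u, huS⟩ fun t ht => ht.1, fun ε hε => ?_⟩
  obtain ⟨t, ht, hlt_t⟩ := exists_lt_of_lt_csSup ⟨u, huS⟩ (sub_lt_self (sSup S) hε)
  refine ((hm hlt_t.le).trans ht.2).trans_lt ?_
  by_contra! hle
  have hv : sSup S + ε ≤ v := by
    by_contra! hv
    exact absurd (huv.trans_le (hm hv.le)) hle.not_gt
  linarith [le_csSup hbdd (show sSup S + ε ∈ S from ⟨hv, hle⟩)]

/-- A real point of an open interval of extended reals has a symmetric neighborhood inside it. -/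
theorem EReal.exists_pos_sub_add_mem {a b : EReal} {x : ℝ} (hax : a < (x : EReal))
    (hxb : (x : EReal) < b) :
    ∃ ε : ℝ, 0 < ε ∧ a < ((x - ε : ℝ) : EReal) ∧ ((x + ε : ℝ) : EReal) < b := by
  obtain ⟨p, hap, hpx⟩ := EReal.lt_iff_exists_real_btwn.1 hax
  obtain ⟨q, hxq, hqb⟩ := EReal.lt_iff_exists_real_btwn.1 hxb
  have hpx' : p < x := EReal.coe_lt_coe_iff.1 hpx
  have hxq' : x < q := EReal.coe_lt_coe_iff.1 hxq
  refine ⟨min (x - p) (q - x), lt_min (by linarith) (by linarith), hap.trans_le ?_,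
    lt_of_le_of_lt ?_ hqb⟩
  · exact EReal.coe_le_coe_iff.2 (by linarith [min_le_left (x - p) (q - x)])
  · exact EReal.coe_le_coe_iff.2 (by linarith [min_le_right (x - p) (q - x)])


/-- Let `m : ℝ → [-∞,∞]` be right-continuous, nondecreasing and
non-constant.  With `l₀ := inf {x : m x > -∞}`, `r₀ := sup {x : m x < ∞}`,
`l := inf {x > l₀ : m x > m l₀}` (where `m l₀ := inf of m over [l₀,∞)`, which is
`m(-∞) := lim_{x → -∞} m x` when `l₀ = -∞`) and
`r := sup {x < r₀ : m x < m(r₀-)}` (where `m(r₀-) := sup of m over (-∞, r₀)` is the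
left limit of `m` at `r₀`), assume `l < r`.  Then
`E_m := {x ∈ [l,r] ∩ (l₀,r₀) : m(x-ε) < m(x+ε) for all ε > 0}` is a nearly closed
subset of `ℝ` ended by `l` and `r`: it is a set of reals whose infimum is `l`,
whose supremum is `r`, and such that `E_m ∪ {l, r}` is closed in `[-∞,∞]`. -/
theorem stmt_0
    (m : ℝ → EReal) (hmono : Monotone m)
    (hrc : ∀ x : ℝ, ContinuousWithinAt m (Set.Ici x) x)
    (hnc : ¬ ∃ c : EReal, ∀ x : ℝ, m x = c)
    (l₀ r₀ l r : EReal)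
    (hl₀ : l₀ = sInf ((fun x : ℝ => (x : EReal)) '' {x : ℝ | ⊥ < m x}))
    (hr₀ : r₀ = sSup ((fun x : ℝ => (x : EReal)) '' {x : ℝ | m x < ⊤}))
    (hl : l = sInf ((fun x : ℝ => (x : EReal)) ''
      {x : ℝ | l₀ < (x : EReal) ∧ sInf (m '' {y : ℝ | l₀ ≤ (y : EReal)}) < m x}))
    (hr : r = sSup ((fun x : ℝ => (x : EReal)) ''
      {x : ℝ | (x : EReal) < r₀ ∧ m x < sSup (m '' {y : ℝ | (y : EReal) < r₀})}))
    (hlr : l < r)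
    (Em : Set ℝ)
    (hEm : Em = {x : ℝ | l ≤ (x : EReal) ∧ (x : EReal) ≤ r ∧ l₀ < (x : EReal) ∧
      (x : EReal) < r₀ ∧ ∀ ε : ℝ, 0 < ε → m (x - ε) < m (x + ε)}) :
    sInf ((fun x : ℝ => (x : EReal)) '' Em) = l ∧
    sSup ((fun x : ℝ => (x : EReal)) '' Em) = r ∧
    IsClosed (((fun x : ℝ => (x : EReal)) '' Em) ∪ {l, r}) := by
  have hl₀l : l₀ ≤ l := by
    rw [hl]
    refine le_sInf ?_
    rintro _ ⟨x, hx, rfl⟩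
    exact hx.1.le
  have hrr₀ : r ≤ r₀ := by
    rw [hr]
    refine sSup_le ?_
    rintro _ ⟨x, hx, rfl⟩
    exact hx.1.le
  have hmem : ∀ x : ℝ, x ∈ Em ↔ l ≤ (x : EReal) ∧ (x : EReal) ≤ r ∧ l₀ < (x : EReal) ∧
      (x : EReal) < r₀ ∧ ∀ ε : ℝ, 0 < ε → m (x - ε) < m (x + ε) := fun x => by
    rw [hEm]; rfl
  have hmem_of : ∀ x : ℝ, l₀ < (x : EReal) → (x : EReal) < r₀ →
      (∀ ε : ℝ, 0 < ε → m (x - ε) < m (x + ε)) → x ∈ Em := by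
    intro x h₀ h₁ hinc
    refine (hmem x).2 ⟨?_, ?_, h₀, h₁, hinc⟩
    · by_contra! hxl
      obtain ⟨ε, hε, hlo, hhi⟩ := EReal.exists_pos_sub_add_mem h₀ hxl
      refine hhi.not_ge (hl.trans_le (sInf_le ⟨x + ε, ⟨?_, ?_⟩, rfl⟩))
      · exact h₀.trans (EReal.coe_lt_coe_iff.2 (by linarith))
      · exact lt_of_le_of_lt (sInf_le ⟨x - ε, hlo.le, rfl⟩) (hinc ε hε)
    · by_contra! hxr
      obtain ⟨ε, hε, hlo, hhi⟩ := EReal.exists_pos_sub_add_mem hxr h₁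
      refine hlo.not_ge (hr.ge.trans' (le_sSup ⟨x - ε, ⟨?_, ?_⟩, rfl⟩))
      · exact (EReal.coe_lt_coe_iff.2 (by linarith : x - ε < x)).trans h₁
      · exact (hinc ε hε).trans_le (le_sSup ⟨x + ε, hhi, rfl⟩)
  refine ⟨le_antisymm (le_of_forall_gt_imp_ge_of_dense fun b hb => ?_) (le_sInf ?_),
    le_antisymm (sSup_le ?_) (le_of_forall_lt_imp_le_of_dense fun a ha => ?_), ?_⟩
  · obtain ⟨_, ⟨v, ⟨hv₀, hv⟩, rfl⟩, hvb⟩ := sInf_lt_iff.1 (hl ▸ lt_min hb hlr)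
    obtain ⟨_, ⟨y, hy, rfl⟩, hyv⟩ := sInf_lt_iff.1 hv
    obtain ⟨u, hu₀, huv⟩ : ∃ u : ℝ, l₀ < (u : EReal) ∧ m u < m v := by
      obtain ⟨u, hu, hyu⟩ := ((((hrc y).mono Set.Ioi_subset_Ici_self).eventually
        (gt_mem_nhds hyv)).and self_mem_nhdsWithin).exists
      exact ⟨u, lt_of_le_of_lt hy (EReal.coe_lt_coe_iff.2 hyu), hu⟩
    obtain ⟨x, hux, hxv, hx⟩ := hmono.exists_point_of_increase huv
    have hxb := (EReal.coe_le_coe_iff.2 hxv).trans_lt hvb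
    refine (sInf_le (Set.mem_image_of_mem _ (hmem_of x
      (hu₀.trans_le (EReal.coe_le_coe_iff.2 hux)) ?_ hx))).trans (hxb.le.trans (min_le_left _ _))
    exact (hxb.trans_le (min_le_right _ _)).trans_le hrr₀
  · rintro _ ⟨x, hx, rfl⟩
    exact ((hmem x).1 hx).1
  · rintro _ ⟨x, hx, rfl⟩
    exact ((hmem x).1 hx).2.1
  · obtain ⟨_, ⟨u, ⟨hu₀, hu⟩, rfl⟩, hau⟩ := lt_sSup_iff.1 (hr ▸ max_lt ha hlr)
    obtain ⟨_, ⟨v, hv, rfl⟩, huv⟩ := lt_sSup_iff.1 hu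
    obtain ⟨x, hux, hxv, hx⟩ := hmono.exists_point_of_increase huv
    have hax := hau.trans_le (EReal.coe_le_coe_iff.2 hux)
    refine ((le_max_left _ _).trans hax.le).trans (le_sSup
      (Set.mem_image_of_mem _ (hmem_of x ?_ ?_ hx)))
    · exact hl₀l.trans_lt ((le_max_right _ _).trans_lt hax)
    · exact (EReal.coe_le_coe_iff.2 hxv).trans_lt hv
  · rw [← isOpen_compl_iff, isOpen_iff_mem_nhds]
    intro z hz
    simp only [Set.mem_compl_iff, Set.mem_union, Set.mem_insert_iff, Set.mem_singleton_iff,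
      not_or] at hz
    obtain ⟨hzE, hzl, hzr⟩ := hz
    rcases lt_or_gt_of_ne hzl with hzl | hzl
    · filter_upwards [Iio_mem_nhds hzl] with w hw
      rintro (⟨x, hx, rfl⟩ | rfl | rfl)
      · exact not_lt_of_ge ((hmem x).1 hx).1 hw
      · exact lt_irrefl w hw
      · exact lt_asymm hlr hw
    rcases lt_or_gt_of_ne hzr with hzr | hzr
    · lift z to ℝ using ⟨(hzr.trans_le le_top).ne, (bot_le.trans_lt hzl).ne'⟩
      have hz_inc : ¬ ∀ ε : ℝ, 0 < ε → m (z - ε) < m (z + ε) := fun h =>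
        hzE ⟨z, hmem_of z (hl₀l.trans_lt hzl) (hzr.trans_le hrr₀) h, rfl⟩
      push Not at hz_inc
      obtain ⟨ε, hε, hle⟩ := hz_inc
      have hlo : ((z - ε : ℝ) : EReal) < z := EReal.coe_lt_coe_iff.2 (by linarith)
      have hhi : (z : EReal) < ((z + ε : ℝ) : EReal) := EReal.coe_lt_coe_iff.2 (by linarith)
      filter_upwards [Ioo_mem_nhds hzl hzr, Ioo_mem_nhds hlo hhi] with w hw hwε
      rintro (⟨x, hx, rfl⟩ | rfl | rfl)
      · obtain ⟨δ, hδ, hδlo, hδhi⟩ := EReal.exists_pos_sub_add_mem hwε.1 hwε.2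
        have h₁ := hmono (EReal.coe_lt_coe_iff.1 hδlo).le
        have h₂ := hmono (EReal.coe_lt_coe_iff.1 hδhi).le
        exact absurd (((hmem x).1 hx).2.2.2.2 δ hδ) (h₂.trans (hle.trans h₁)).not_gt
      · exact lt_irrefl _ hw.1
      · exact lt_irrefl _ hw.2
    · filter_upwards [Ioi_mem_nhds hzr] with w hw
      rintro (⟨x, hx, rfl⟩ | rfl | rfl)
      · exact not_lt_of_ge ((hmem x).1 hx).2.1 hw
      · exact lt_asymm hlr hw
      · exact lt_irrefl w hw
end

section
/- Let E ⊆ [-∞,∞] be a set with at least two elements and let s, s̃ : E → ℝ be strictly increasing functions such that for all a, x, b ∈ E with a < x < b, (s(x) - s(a))/(s(b) - s(a)) = (s̃(x) - s̃(a))/(s̃(b) - s̃(a)). Then there exist constants α > 0 and β ∈ ℝ such that s̃(x) = α·s(x) + β for all x ∈ E. -/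
/-- Cross-multiplied form of the equality of three-point ratios. -/
theorem cross_mul_of_ratio_eq {ι : Type*} [Preorder ι] {E : Set ι} {s t : ι → ℝ}
    (hs : StrictMonoOn s E) (ht : StrictMonoOn t E)
    (hratio : ∀ a ∈ E, ∀ x ∈ E, ∀ b ∈ E, a < x → x < b →
      (s x - s a) / (s b - s a) = (t x - t a) / (t b - t a))
    {a x b : ι} (ha : a ∈ E) (hx : x ∈ E) (hb : b ∈ E) (hax : a < x) (hxb : x < b) :
    (s x - s a) * (t b - t a) = (t x - t a) * (s b - s a) :=
  (div_eq_div_iff (sub_pos.2 (hs ha hb (hax.trans hxb))).ne'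
    (sub_pos.2 (ht ha hb (hax.trans hxb))).ne').1 (hratio a ha x hx b hb hax hxb)


/-- Let `E ⊆ [-∞,∞]` have at least two elements and let
`s, s̃ : E → ℝ` be strictly increasing functions inducing the same three-point
ratios `(s x - s a)/(s b - s a) = (s̃ x - s̃ a)/(s̃ b - s̃ a)` for all
`a < x < b` in `E`.  Then `s̃ = α • s + β` on `E` for some `α > 0`, `β ∈ ℝ`. -/
theorem stmt_2
    (E : Set EReal) (s st : EReal → ℝ)
    (hs : StrictMonoOn s E) (hst : StrictMonoOn st E)
    (htwo : ∃ x ∈ E, ∃ y ∈ E, x ≠ y)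
    (hratio : ∀ a ∈ E, ∀ x ∈ E, ∀ b ∈ E, a < x → x < b →
      (s x - s a) / (s b - s a) = (st x - st a) / (st b - st a)) :
    ∃ α β : ℝ, 0 < α ∧ ∀ x ∈ E, st x = α * s x + β := by
  obtain ⟨p, hp, q, hq, hpq⟩ : ∃ p ∈ E, ∃ q ∈ E, p < q := by
    obtain ⟨x, hx, y, hy, hxy⟩ := htwo
    rcases hxy.lt_or_gt with h | h
    exacts [⟨x, hx, y, hy, h⟩, ⟨y, hy, x, hx, h⟩]
  have hspq : 0 < s q - s p := sub_pos.2 (hs hp hq hpq)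
  have hstpq : 0 < st q - st p := sub_pos.2 (hst hp hq hpq)
  refine ⟨(st q - st p) / (s q - s p), st p - (st q - st p) / (s q - s p) * s p,
    div_pos hstpq hspq, fun x hx => ?_⟩
  have key : (st x - st p) * (s q - s p) = (s x - s p) * (st q - st p) := by
    rcases lt_trichotomy x p with hxp | rfl | hpx
    · linarith [cross_mul_of_ratio_eq hs hst hratio hx hp hq hxp hpq]
    · ring
    · rcases lt_trichotomy x q with hxq | rfl | hqx
      · linarith [cross_mul_of_ratio_eq hs hst hratio hp hx hq hpx hxq]
      · ring
      · linarith [cross_mul_of_ratio_eq hs hst hratio hp hq hx hpq hqx]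
  field_simp
  linarith
end

section
/- Let a < b be real numbers and let E ⊆ [a,b] be a closed set with a, b ∈ E. Write the open set [a,b] ∖ E as a countable disjoint union of open intervals (a_k, b_k), k ≥ 1, whose endpoints a_k, b_k lie in E. Let h : [a,b] → ℝ be a function such that: (i) for each k and each x ∈ (a_k, b_k), h(x) = h(a_k) + ((h(b_k) - h(a_k))/(b_k - a_k))·(x - a_k) (linear interpolation on each gap); and (ii) for all x, y, z ∈ E with x < y < z, h(y) ≥ ((z-y)/(z-x))·h(x) + ((y-x)/(z-x))·h(z). Then h is concave on [a,b], i.e., the inequality in (ii) holds for all real x < y < z in [a,b]. -/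
/-- The division-free defect in the three-point concavity inequality for `h` at `x, y, z`. -/
def concavityDefect (h : ℝ → ℝ) (x y z : ℝ) : ℝ :=
  (z - x) * h y - (z - y) * h x - (y - x) * h z

lemma concavityDefect_nonneg_iff {h : ℝ → ℝ} {x y z : ℝ} (hxz : x < z) :
    0 ≤ concavityDefect h x y z ↔
      ((z - y) / (z - x)) * h x + ((y - x) / (z - x)) * h z ≤ h y := by
  have hpos : 0 < z - x := sub_pos.mpr hxz
  rw [div_mul_eq_mul_div, div_mul_eq_mul_div, ← add_div, div_le_iff₀ hpos, concavityDefect]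
  constructor <;> intro <;> linarith

@[simp]
lemma concavityDefect_self_left (h : ℝ → ℝ) (x z : ℝ) : concavityDefect h x x z = 0 := by
  simp [concavityDefect]

@[simp]
lemma concavityDefect_self_right (h : ℝ → ℝ) (x z : ℝ) : concavityDefect h x z z = 0 := by
  simp [concavityDefect]

lemma affine_nonneg_of_endpoints {A B u v t : ℝ} (hut : u ≤ t) (htv : t ≤ v)
    (hu : 0 ≤ A + B * u) (hv : 0 ≤ A + B * v) : 0 ≤ A + B * t := by
  rcases le_total 0 B with hB | hB
  · linarith [mul_le_mul_of_nonneg_left hut hB]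
  · linarith [mul_le_mul_of_nonpos_left htv hB]

lemma concavityDefect_nonneg_of_affine_left {h : ℝ → ℝ} {c m p q y z t : ℝ}
    (hpq : ∀ s ∈ Set.Icc p q, h s = c + m * s) (ht : t ∈ Set.Icc p q)
    (hp : 0 ≤ concavityDefect h p y z) (hq : 0 ≤ concavityDefect h q y z) :
    0 ≤ concavityDefect h t y z := by
  have key : ∀ s ∈ Set.Icc p q, concavityDefect h s y z =
      (z * h y - (z - y) * c - y * h z) + (h z - h y - (z - y) * m) * s := by
    intro s hs
    rw [concavityDefect, hpq s hs]
    ring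
  have hle := ht.1.trans ht.2
  rw [key _ (Set.left_mem_Icc.mpr hle)] at hp
  rw [key _ (Set.right_mem_Icc.mpr hle)] at hq
  rw [key t ht]
  exact affine_nonneg_of_endpoints ht.1 ht.2 hp hq

lemma concavityDefect_nonneg_of_affine_mid {h : ℝ → ℝ} {c m p q x z t : ℝ}
    (hpq : ∀ s ∈ Set.Icc p q, h s = c + m * s) (ht : t ∈ Set.Icc p q)
    (hp : 0 ≤ concavityDefect h x p z) (hq : 0 ≤ concavityDefect h x q z) :
    0 ≤ concavityDefect h x t z := by
  have key : ∀ s ∈ Set.Icc p q, concavityDefect h x s z =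
      ((z - x) * c - z * h x + x * h z) + ((z - x) * m + h x - h z) * s := by
    intro s hs
    rw [concavityDefect, hpq s hs]
    ring
  have hle := ht.1.trans ht.2
  rw [key _ (Set.left_mem_Icc.mpr hle)] at hp
  rw [key _ (Set.right_mem_Icc.mpr hle)] at hq
  rw [key t ht]
  exact affine_nonneg_of_endpoints ht.1 ht.2 hp hq

lemma concavityDefect_nonneg_of_affine_right {h : ℝ → ℝ} {c m p q x y t : ℝ}
    (hpq : ∀ s ∈ Set.Icc p q, h s = c + m * s) (ht : t ∈ Set.Icc p q)
    (hp : 0 ≤ concavityDefect h x y p) (hq : 0 ≤ concavityDefect h x y q) :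
    0 ≤ concavityDefect h x y t := by
  have key : ∀ s ∈ Set.Icc p q, concavityDefect h x y s =
      (- x * h y + y * h x - (y - x) * c) + (h y - h x - (y - x) * m) * s := by
    intro s hs
    rw [concavityDefect, hpq s hs]
    ring
  have hle := ht.1.trans ht.2
  rw [key _ (Set.left_mem_Icc.mpr hle)] at hp
  rw [key _ (Set.right_mem_Icc.mpr hle)] at hq
  rw [key t ht]
  exact affine_nonneg_of_endpoints ht.1 ht.2 hp hq

/-- If every point of `S` lies in an interval with endpoints in `E`, no point of `E` inside,
and `h` affine on it, then the three-point inequality extends from `E` to `S`. -/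
lemma concavityDefect_nonneg_of_piecewise_affine {h : ℝ → ℝ} {E S : Set ℝ}
    (hcover : ∀ t ∈ S, ∃ p ∈ E, ∃ q ∈ E, t ∈ Set.Icc p q ∧ (∀ e ∈ E, e ≤ p ∨ q ≤ e) ∧
      ∃ c m, ∀ s ∈ Set.Icc p q, h s = c + m * s)
    (hE : ∀ x ∈ E, ∀ y ∈ E, ∀ z ∈ E, x ≤ y → y ≤ z → 0 ≤ concavityDefect h x y z)
    {x y z : ℝ} (hx : x ∈ S) (hy : y ∈ S) (hz : z ∈ S) (hxy : x ≤ y) (hyz : y ≤ z) :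
    0 ≤ concavityDefect h x y z := by
  have extend_right : ∀ x ∈ E, ∀ y ∈ E, ∀ z ∈ S, x ≤ y → y ≤ z →
      0 ≤ concavityDefect h x y z := by
    intro x hx y hy z hz hxy hyz
    obtain ⟨p, hp, q, hq, hzpq, hgap, c, m, haff⟩ := hcover z hz
    rcases hgap y hy with hyp | hqy
    · exact concavityDefect_nonneg_of_affine_right haff hzpq (hE x hx y hy p hp hxy hyp)
        (hE x hx y hy q hq hxy (hyz.trans hzpq.2))
    · rw [le_antisymm hyz (hzpq.2.trans hqy), concavityDefect_self_right]
  have extend_left : ∀ x ∈ S, ∀ y ∈ E, ∀ z ∈ S, x ≤ y → y ≤ z →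
      0 ≤ concavityDefect h x y z := by
    intro x hx y hy z hz hxy hyz
    obtain ⟨p, hp, q, hq, hxpq, hgap, c, m, haff⟩ := hcover x hx
    rcases hgap y hy with hyp | hqy
    · rw [le_antisymm hxy (hyp.trans hxpq.1), concavityDefect_self_left]
    · exact concavityDefect_nonneg_of_affine_left haff hxpq
        (extend_right p hp y hy z hz (hxpq.1.trans hxy) hyz)
        (extend_right q hq y hy z hz hqy hyz)
  obtain ⟨p, hp, q, hq, hypq, -, c, m, haff⟩ := hcover y hy
  refine concavityDefect_nonneg_of_affine_mid (p := max x p) (q := min z q)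
    (fun s hs => haff s ⟨(le_max_right _ _).trans hs.1, hs.2.trans (min_le_right _ _)⟩)
    ⟨max_le hxy hypq.1, le_min hyz hypq.2⟩ ?_ ?_
  · rcases le_total x p with hxp | hpx
    · rw [max_eq_right hxp]
      exact extend_left x hx p hp z hz hxp (hypq.1.trans hyz)
    · rw [max_eq_left hpx, concavityDefect_self_left]
  · rcases le_total z q with hzq | hqz
    · rw [min_eq_left hzq, concavityDefect_self_right]
    · rw [min_eq_right hqz]
      exact extend_left x hx q hq z hz (hxy.trans hypq.2) hqz


/-- Let `a < b` be reals, `E ⊆ [a,b]` closed with `a, b ∈ E`, and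
write `[a,b] \ E` as a countable disjoint union of open intervals `(aK k, bK k)`
with endpoints in `E`.  If `h : [a,b] → ℝ` interpolates linearly on each gap and
satisfies the three-point concavity inequality on `E`, then `h` is concave on
`[a,b]`, i.e. the three-point inequality holds for all `x < y < z` in `[a,b]`. -/
theorem stmt_3
    {a b : ℝ} (hab : a < b) (E : Set ℝ) (hEclosed : IsClosed E)
    (hEsub : E ⊆ Set.Icc a b) (haE : a ∈ E) (hbE : b ∈ E)
    {ι : Type*} [Countable ι] (aK bK : ι → ℝ)
    (haK : ∀ k, aK k ∈ E) (hbK : ∀ k, bK k ∈ E) (hlt : ∀ k, aK k < bK k)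
    (hdisj : Pairwise (Function.onFun Disjoint fun k => Set.Ioo (aK k) (bK k)))
    (hunion : (⋃ k, Set.Ioo (aK k) (bK k)) = Set.Icc a b \ E)
    (h : ℝ → ℝ)
    (hlin : ∀ k, ∀ x ∈ Set.Ioo (aK k) (bK k),
      h x = h (aK k) + ((h (bK k) - h (aK k)) / (bK k - aK k)) * (x - aK k))
    (hconc : ∀ x ∈ E, ∀ y ∈ E, ∀ z ∈ E, x < y → y < z →
      ((z - y) / (z - x)) * h x + ((y - x) / (z - x)) * h z ≤ h y) :
    ∀ x ∈ Set.Icc a b, ∀ y ∈ Set.Icc a b, ∀ z ∈ Set.Icc a b, x < y → y < z →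
      ((z - y) / (z - x)) * h x + ((y - x) / (z - x)) * h z ≤ h y := by
  intro x hx y hy z hz hxy hyz
  rw [← concavityDefect_nonneg_iff (hxy.trans hyz)]
  refine concavityDefect_nonneg_of_piecewise_affine (E := E) ?_ ?_ hx hy hz hxy.le hyz.le
  · intro t ht
    by_cases htE : t ∈ E
    · refine ⟨t, htE, t, htE, ⟨le_rfl, le_rfl⟩, fun e _ => le_total e t, h t, 0, ?_⟩
      intro s hs
      rw [le_antisymm hs.2 hs.1, zero_mul, add_zero]
    · obtain ⟨k, hk⟩ := Set.mem_iUnion.mp (hunion.superset ⟨ht, htE⟩)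
      refine ⟨aK k, haK k, bK k, hbK k, Set.Ioo_subset_Icc_self hk, fun e he => ?_,
        h (aK k) - (h (bK k) - h (aK k)) / (bK k - aK k) * aK k,
        (h (bK k) - h (aK k)) / (bK k - aK k), fun s hs => ?_⟩
      · by_contra! hcon
        exact (hunion.subset (Set.mem_iUnion.mpr ⟨k, hcon⟩)).2 he
      · have hne : bK k - aK k ≠ 0 := (sub_pos.mpr (hlt k)).ne'
        rcases hs.1.eq_or_lt with rfl | h1
        · ring
        rcases hs.2.eq_or_lt with rfl | h2
        · field_simp
          ring
        · rw [hlin k s ⟨h1, h2⟩]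
          ring
  · intro x hx y hy z hz hxy hyz
    rcases hxy.eq_or_lt with rfl | hxy
    · simp
    rcases hyz.eq_or_lt with rfl | hyz
    · simp
    exact (concavityDefect_nonneg_iff (hxy.trans hyz)).mpr (hconc x hx y hy z hz hxy hyz)
end

section
/- Let a < b (possibly infinite), let E ⊆ (a,b) be a set that is closed in (a,b), and let h : (a,b) → ℝ be a concave function such that: (i) h is affine on each connected component of (a,b) ∖ E; and (ii) for every x ∈ E and all α, β ∈ (a,b) with α < x < β, the strict inequality h(x) > ((β-x)/(β-α))·h(α) + ((x-α)/(β-α))·h(β) holds. Let g denote the right-hand derivative of h (which exists everywhere on (a,b), is nonincreasing and right-continuous since h is concave), and let μ be the Lebesgue–Stieltjes measure on (a,b) induced by the nondecreasing right-continuous function -g. Then the topological support of μ in (a,b) is exactly E; in particular, for every open interval (α,β) ⊆ (a,b), μ((α,β)) = 0 if and only if (α,β) ∩ E = ∅. -/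
open Set Filter Topology MeasureTheory

theorem ConcaveOn.le_slope_of_hasDerivWithinAt_Ioi {I : Set ℝ} {h : ℝ → ℝ} {x t g : ℝ}
    (hconc : ConcaveOn ℝ I h) (hI : IsOpen I) (hx : x ∈ I) (ht : t ∈ I) (hxt : x < t)
    (hg : HasDerivWithinAt h g (Ioi t) t) :
    g ≤ (h t - h x) / (t - x) := by
  rw [hasDerivWithinAt_iff_tendsto_slope' (by simp)] at hg
  refine le_of_tendsto hg ?_
  filter_upwards [mem_nhdsWithin_of_mem_nhds (hI.mem_nhds ht), self_mem_nhdsWithin] with u hu htu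
  simpa [slope_def_field] using hconc.slope_anti_adjacent hx hu hxt htu

/-- A point where the three-point inequality is strict is a point of strict decrease of the
right-hand derivative. -/
theorem ConcaveOn.rightDeriv_lt_of_three_point {I : Set ℝ} {h : ℝ → ℝ} {s x t gs gt : ℝ}
    (hconc : ConcaveOn ℝ I h) (hI : IsOpen I) (hs : s ∈ I) (hx : x ∈ I) (ht : t ∈ I)
    (hsx : s < x) (hxt : x < t)
    (hgs : HasDerivWithinAt h gs (Ioi s) s) (hgt : HasDerivWithinAt h gt (Ioi t) t)
    (hstrict : ((t - x) / (t - s)) * h s + ((x - s) / (t - s)) * h t < h x) :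
    gt < gs := by
  refine (hconc.le_slope_of_hasDerivWithinAt_Ioi hI hx ht hxt hgt).trans_lt
    (lt_of_lt_of_le ?_ (hconc.slope_le_of_hasDerivWithinAt_Ioi hs hx hsx hgs))
  have hts : 0 < t - s := by linarith
  rw [div_mul_eq_mul_div, div_mul_eq_mul_div, ← add_div, div_lt_iff₀ hts] at hstrict
  rw [slope_def_field, div_lt_div_iff₀ (by linarith) (by linarith)]
  nlinarith

theorem rightDeriv_eq_of_affine_on_Ioo {h : ℝ → ℝ} {α β c d x g : ℝ}
    (haff : ∀ y ∈ Ioo α β, h y = c * y + d) (hx : x ∈ Ioo α β)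
    (hg : HasDerivWithinAt h g (Ioi x) x) : g = c := by
  have hlin : HasDerivWithinAt (fun y : ℝ => c * y + d) c (Ioi x) x := by
    simpa using (((hasDerivAt_id x).const_mul c).add_const d).hasDerivWithinAt
  have hh : HasDerivWithinAt h c (Ioi x) x :=
    hlin.congr_of_eventuallyEq
      (by filter_upwards [mem_nhdsWithin_of_mem_nhds (isOpen_Ioo.mem_nhds hx)] with y hy
          using haff y hy)
      (haff x hx)
  exact (uniqueDiffWithinAt_Ioi x).eq_deriv _ hg hh

theorem measure_Ioo_eq_zero_of_Ioc {μ : Measure ℝ} {α β : ℝ}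
    (hμ : ∀ s ∈ Ioo α β, ∀ t ∈ Ioo α β, s ≤ t → μ (Ioc s t) = 0) : μ (Ioo α β) = 0 := by
  refine measure_null_of_locally_null _ fun x hx => ?_
  obtain ⟨s, hs, hsx⟩ := exists_between hx.1
  obtain ⟨t, hxt, ht⟩ := exists_between hx.2
  exact ⟨Ioc s t, mem_nhdsWithin_of_mem_nhds (Ioc_mem_nhds hsx hxt),
    hμ s ⟨hs, by linarith [hx.2]⟩ t ⟨by linarith [hx.1], ht⟩ (by linarith)⟩

/-- Let `a < b` in `[-∞,∞]`, `I := (a,b) ⊆ ℝ`, `E ⊆ I` closed in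
`I`, and `h : I → ℝ` concave, affine on each connected component of `I \ E`, and
satisfying the strict three-point inequality at each point of `E`.  Let `g` be the
right-hand derivative of `h` and `μ` the Lebesgue–Stieltjes measure induced on `I`
by the nondecreasing right-continuous function `-g` (so `μ((s,t]) = g s - g t`).
Then the topological support of `μ` in `I` is exactly `E`; in particular, for every
open interval `(α,β) ⊆ I`, `μ((α,β)) = 0` iff `(α,β) ∩ E = ∅`. -/
theorem stmt_4
    (a b : EReal) (hab : a < b)
    (I : Set ℝ) (hI : I = {x : ℝ | a < (x : EReal) ∧ (x : EReal) < b})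
    (E : Set ℝ) (hEI : E ⊆ I) (hEclosed : closure E ∩ I ⊆ E)
    (h g : ℝ → ℝ) (hconc : ConcaveOn ℝ I h)
    (haff : ∀ x ∈ I \ E, ∃ c d : ℝ,
      ∀ y ∈ connectedComponentIn (I \ E) x, h y = c * y + d)
    (hstrict : ∀ x ∈ E, ∀ α ∈ I, ∀ β ∈ I, α < x → x < β →
      ((β - x) / (β - α)) * h α + ((x - α) / (β - α)) * h β < h x)
    (hg : ∀ x ∈ I, HasDerivWithinAt h (g x) (Set.Ioi x) x)
    (μ : MeasureTheory.Measure ℝ)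
    (hμ : ∀ s ∈ I, ∀ t ∈ I, s ≤ t → μ (Set.Ioc s t) = ENNReal.ofReal (g s - g t)) :
    E = {x : ℝ | x ∈ I ∧ ∀ ε : ℝ, 0 < ε → 0 < μ (Set.Ioo (x - ε) (x + ε) ∩ I)} ∧
    ∀ α ∈ I, ∀ β ∈ I, α < β → (μ (Set.Ioo α β) = 0 ↔ Set.Ioo α β ∩ E = ∅) := by
  have hIo : IsOpen I := by
    rw [hI]
    exact (isOpen_Ioi.preimage continuous_coe_real_ereal).inter
      (isOpen_Iio.preimage continuous_coe_real_ereal)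
  have hIoo : ∀ α ∈ I, ∀ β ∈ I, Ioo α β ⊆ I := fun α hα β hβ =>
    Ioo_subset_Icc_self.trans (hconc.1.ordConnected.out hα hβ)
  have key : ∀ α ∈ I, ∀ β ∈ I, α < β → (μ (Ioo α β) = 0 ↔ Ioo α β ∩ E = ∅) := by
    intro α hα β hβ hαβ
    have hsub := hIoo α hα β hβ
    constructor
    · intro h0
      by_contra hne
      obtain ⟨x, hx, hxE⟩ := nonempty_iff_ne_empty.2 hne
      obtain ⟨s, hs, hsx⟩ := exists_between hx.1
      obtain ⟨t, hxt, ht⟩ := exists_between hx.2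
      have hsI : s ∈ I := hsub ⟨hs, by linarith⟩
      have htI : t ∈ I := hsub ⟨by linarith, ht⟩
      have hlt : g t < g s := hconc.rightDeriv_lt_of_three_point hIo hsI (hEI hxE) htI hsx hxt
        (hg s hsI) (hg t htI) (hstrict x hxE s hsI t htI hsx hxt)
      have hz : μ (Ioc s t) = 0 :=
        measure_mono_null ((Ioc_subset_Ioc_left hs.le).trans (Ioc_subset_Ioo_right ht)) h0
      rw [hμ s hsI t htI (by linarith), ENNReal.ofReal_eq_zero] at hz
      linarith
    · intro hE
      rw [← disjoint_iff_inter_eq_empty, disjoint_left] at hE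
      have hsubE : Ioo α β ⊆ I \ E := fun y hy =>
        ⟨hsub hy, hE hy⟩
      obtain ⟨m, hm⟩ := nonempty_Ioo.2 hαβ
      obtain ⟨c, d, hcd⟩ := haff m (hsubE hm)
      have hcomp : Ioo α β ⊆ connectedComponentIn (I \ E) m :=
        isPreconnected_Ioo.subset_connectedComponentIn hm hsubE
      have hgc : ∀ s ∈ Ioo α β, g s = c := fun s hs =>
        rightDeriv_eq_of_affine_on_Ioo (fun y hy => hcd y (hcomp hy)) hs (hg s (hsub hs))
      refine measure_Ioo_eq_zero_of_Ioc fun s hs t ht hst => ?_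
      rw [hμ s (hsub hs) t (hsub ht) hst, hgc s hs, hgc t ht, sub_self, ENNReal.ofReal_zero]
  refine ⟨Subset.antisymm ?_ ?_, key⟩
  · refine fun x hxE => ⟨hEI hxE, fun ε hε => ?_⟩
    obtain ⟨δ, hδ, hball⟩ := Metric.nhds_basis_closedBall.mem_iff.1
      ((hIo.inter isOpen_Ioo).mem_nhds
        (⟨hEI hxE, by linarith, by linarith⟩ : x ∈ I ∩ Ioo (x - ε) (x + ε)))
    rw [Real.closedBall_eq_Icc] at hball
    have hl := hball (left_mem_Icc.2 (by linarith))
    have hr := hball (right_mem_Icc.2 (by linarith))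
    have hpos : μ (Ioo (x - δ) (x + δ)) ≠ 0 := by
      rw [Ne, key _ hl.1 _ hr.1 (by linarith)]
      exact nonempty_iff_ne_empty.1 ⟨x, ⟨by linarith, by linarith⟩, hxE⟩
    refine (pos_iff_ne_zero.2 hpos).trans_le (measure_mono fun y hy => ?_)
    exact (hball (Ioo_subset_Icc_self hy)).symm
  · rintro x ⟨hxI, hx⟩
    by_contra hxE
    have hxcl : x ∈ I ∩ (closure E)ᶜ := ⟨hxI, fun hc => hxE (hEclosed ⟨hc, hxI⟩)⟩
    obtain ⟨δ, hδ, hball⟩ := Metric.nhds_basis_closedBall.mem_iff.1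
      ((hIo.inter isClosed_closure.isOpen_compl).mem_nhds hxcl)
    rw [Real.closedBall_eq_Icc] at hball
    have hl := hball (left_mem_Icc.2 (by linarith))
    have hr := hball (right_mem_Icc.2 (by linarith))
    have h0 : μ (Ioo (x - δ) (x + δ)) = 0 := by
      rw [key _ hl.1 _ hr.1 (by linarith), ← disjoint_iff_inter_eq_empty, disjoint_left]
      exact fun y hy hyE => (hball (Ioo_subset_Icc_self hy)).2 (subset_closure hyE)
    exact (hx δ hδ).ne' (measure_mono_null inter_subset_left h0)
end

section
/- Let E be a nearly closed subset of the extended reals ended by l and r, and let (a_k, b_k), k ≥ 1, be the connected components of the open set [l,r] ∖ (E ∪ {l,r}). Then the set F := {(a_k, b_k) : k ≥ 1} ∪ {(b_k, a_k) : k ≥ 1} is a closed subset of the space {(x,y) ∈ E̅ × E̅ : x ≠ y} (with the subspace topology), where E̅ := E ∪ {l,r}. Equivalently: if (x,y) with x ≠ y is a limit of a sequence of points of the form (a_{k_n}, b_{k_n}) or (b_{k_n}, a_{k_n}), then (x,y) itself equals (a_k, b_k) or (b_k, a_k) for some k. -/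
/-- The set of endpoint pairs, in either order, of a pairwise disjoint family of open intervals
is closed off the diagonal at points above it. -/
theorem exists_eq_of_mem_closure_endpoints_of_lt {α ι : Type*} [LinearOrder α]
    [DenselyOrdered α] [TopologicalSpace α] [OrderTopology α] {a b : ι → α}
    (hlt : ∀ k, a k < b k)
    (hdisj : Pairwise (Function.onFun Disjoint fun k => Set.Ioo (a k) (b k)))
    {p : α × α} (hp : p.1 < p.2)
    (hcl : p ∈ closure {q : α × α | ∃ k, q = (a k, b k) ∨ q = (b k, a k)}) :
    ∃ k, p = (a k, b k) := by
  obtain ⟨z, hz₁, hz₂⟩ := exists_between hp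
  have hU : IsOpen (Set.Iio z ×ˢ Set.Ioi z) := isOpen_Iio.prod isOpen_Ioi
  have key : ∀ q ∈ Set.Iio z ×ˢ Set.Ioi z ∩
      {q : α × α | ∃ k, q = (a k, b k) ∨ q = (b k, a k)},
      ∃ k, z ∈ Set.Ioo (a k) (b k) ∧ q = (a k, b k) := by
    rintro q ⟨⟨h₁, h₂⟩, k, rfl | rfl⟩
    · exact ⟨k, ⟨h₁, h₂⟩, rfl⟩
    · exact absurd (hlt k) (lt_trans h₁ h₂).asymm
  have hcl' := hU.inter_closure ⟨⟨hz₁, hz₂⟩, hcl⟩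
  obtain ⟨q, hq⟩ := closure_nonempty_iff.1 ⟨p, hcl'⟩
  obtain ⟨k, hzk, -⟩ := key q hq
  refine ⟨k, ?_⟩
  rw [← Set.mem_singleton_iff, ← closure_singleton]
  refine closure_mono (fun q' hq' => ?_) hcl'
  obtain ⟨j, hzj, rfl⟩ := key q' hq'
  rw [hdisj.eq (Set.not_disjoint_iff.2 ⟨z, hzj, hzk⟩)]
  rfl

/-- Let `E` be a nearly closed subset of `[-∞,∞]` ended by
`l := inf E` and `r := sup E` (i.e. `E̅ := E ∪ {l,r}` is closed), and let
`(aK k, bK k)` be the connected components (gaps) of `[l,r] \ E̅`.  Then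
`F := {(aK k, bK k)} ∪ {(bK k, aK k)}` is closed in the subspace
`{(x,y) ∈ E̅ × E̅ : x ≠ y}`: any point `(x,y)` of this subspace lying in the
closure of `F` belongs to `F`. -/
theorem stmt_5
    (E : Set EReal) (l r : EReal) (hl : l = sInf E) (hr : r = sSup E)
    (hclosed : IsClosed (E ∪ {l, r}))
    {ι : Type*} [Countable ι] (aK bK : ι → EReal)
    (haK : ∀ k, aK k ∈ E ∪ {l, r}) (hbK : ∀ k, bK k ∈ E ∪ {l, r})
    (hlt : ∀ k, aK k < bK k)
    (hdisj : Pairwise (Function.onFun Disjoint fun k => Set.Ioo (aK k) (bK k)))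
    (hgaps : (⋃ k, Set.Ioo (aK k) (bK k)) = Set.Icc l r \ (E ∪ {l, r}))
    (F : Set (EReal × EReal))
    (hF : F = {p : EReal × EReal | ∃ k, p = (aK k, bK k) ∨ p = (bK k, aK k)}) :
    ∀ p : EReal × EReal, p.1 ∈ E ∪ {l, r} → p.2 ∈ E ∪ {l, r} → p.1 ≠ p.2 →
      p ∈ closure F → p ∈ F := by
  intro p _ _ hne hp
  subst hF
  rcases hne.lt_or_gt with h | h
  · obtain ⟨k, hk⟩ := exists_eq_of_mem_closure_endpoints_of_lt hlt hdisj h hp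
    exact ⟨k, Or.inl hk⟩
  · have hswap : p.swap ∈
        closure {q : EReal × EReal | ∃ k, q = (aK k, bK k) ∨ q = (bK k, aK k)} := by
      refine map_mem_closure continuous_swap hp ?_
      rintro _ ⟨k, rfl | rfl⟩
      · exact ⟨k, Or.inr rfl⟩
      · exact ⟨k, Or.inl rfl⟩
    obtain ⟨k, hk⟩ := exists_eq_of_mem_closure_endpoints_of_lt hlt hdisj h hswap
    exact ⟨k, Or.inr (Prod.swap_injective hk)⟩
end

section
/- Let E be a nearly closed subset of ℝ ended by l and r with l < 0 < r, and let μ be a Borel measure concentrated on E, finite on compact subsets of E, with support equal to E (every open set meeting E has positive μ-measure). Define m : ℝ → [-∞,∞] by: m(x) := 2·μ((0,x]) for x ∈ [0, r); m(x) := -2·μ((x,0]) for x ∈ [max(l,-∞), 0) (i.e., for x ∈ [l,0) when l > -∞ and for all x < 0 when l = -∞); if r < ∞ then m(x) := ∞ for x ≥ r when r ∉ E, and m(x) := 2·μ((0,r]) for x ≥ r when r ∈ E; if l > -∞ then m(x) := -∞ for x < l when l ∉ E, and m(x) := -2·μ([l,0]) for x < l when l ∈ E. Then m is right-continuous, nondecreasing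 and non-constant, and with l₀ := inf{x : m(x) > -∞}, r₀ := sup{x : m(x) < ∞}, the following hold: (i) if l₀ > -∞ then l₀ = l, and if r₀ < ∞ then r₀ = r; (ii) E_m := {x ∈ [l,r] ∩ (l₀,r₀) : m(x-ε) < m(x+ε) for every ε > 0} equals E; (iii) the Lebesgue–Stieltjes measure of m restricted to E equals 2μ. -/
open MeasureTheory
open scoped ENNReal

section

open Set Filter Topology

/-- The right-continuous primitive of `2μ` vanishing at `0`, with values in `[-∞,∞]`. -/
noncomputable def doublePrimitive (μ : Measure ℝ) (x : ℝ) : EReal :=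
  if 0 ≤ x then ((2 * μ (Ioc 0 x) : ℝ≥0∞) : EReal) else -((2 * μ (Ioc x 0) : ℝ≥0∞) : EReal)

/-- `x` is strictly to the right of `l`, or `l` is attained in `E`. -/
def IsPastLeftEnd (E : Set ℝ) (l : EReal) (x : ℝ) : Prop :=
  l < x ∨ ∃ e ∈ E, (e : EReal) = l

/-- `x` is strictly to the left of `r`, or `r` is attained in `E`. -/
def IsBeforeRightEnd (E : Set ℝ) (r : EReal) (x : ℝ) : Prop :=
  x < r ∨ ∃ e ∈ E, (e : EReal) = r

section Primitive

variable {μ : Measure ℝ}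

theorem doublePrimitive_of_nonneg {x : ℝ} (hx : 0 ≤ x) :
    doublePrimitive μ x = ((2 * μ (Ioc 0 x) : ℝ≥0∞) : EReal) :=
  if_pos hx

theorem doublePrimitive_of_neg {x : ℝ} (hx : x < 0) :
    doublePrimitive μ x = -((2 * μ (Ioc x 0) : ℝ≥0∞) : EReal) :=
  if_neg hx.not_ge

theorem doublePrimitive_nonneg {x : ℝ} (hx : 0 ≤ x) : 0 ≤ doublePrimitive μ x := by
  rw [doublePrimitive_of_nonneg hx]
  exact EReal.coe_ennreal_nonneg _

theorem doublePrimitive_nonpos {x : ℝ} (hx : x < 0) : doublePrimitive μ x ≤ 0 := by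
  rw [doublePrimitive_of_neg hx, EReal.neg_le, neg_zero]
  exact EReal.coe_ennreal_nonneg _

theorem monotone_doublePrimitive : Monotone (doublePrimitive μ) := by
  intro s t hst
  rcases lt_or_ge s 0 with hs | hs
  · rcases lt_or_ge t 0 with ht | ht
    · rw [doublePrimitive_of_neg hs, doublePrimitive_of_neg ht, EReal.neg_le_neg_iff,
        EReal.coe_ennreal_le_coe_ennreal_iff]
      gcongr
    · exact (doublePrimitive_nonpos hs).trans (doublePrimitive_nonneg ht)
  · rw [doublePrimitive_of_nonneg hs, doublePrimitive_of_nonneg (hs.trans hst),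
      EReal.coe_ennreal_le_coe_ennreal_iff]
    gcongr

theorem coe_two_mul_measure {A : Set ℝ} (hA : μ A ≠ ⊤) :
    ((2 * μ A : ℝ≥0∞) : EReal) = ((2 * μ.real A : ℝ) : EReal) := by
  rw [← EReal.coe_ennreal_toReal (ENNReal.mul_ne_top (by simp) hA), ENNReal.toReal_mul]
  simp [measureReal_def]

theorem measureReal_Ioc_of_le {a b : ℝ} (hba : b ≤ a) : μ.real (Ioc a b) = 0 := by
  rw [Ioc_eq_empty hba.not_gt, measureReal_empty]

theorem doublePrimitive_eq_coe {x : ℝ} (h : μ (Icc (min x 0) (max x 0)) ≠ ⊤) :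
    doublePrimitive μ x = ((2 * μ.real (Ioc 0 x) - 2 * μ.real (Ioc x 0) : ℝ) : EReal) := by
  rcases lt_or_ge x 0 with hx | hx
  · rw [doublePrimitive_of_neg hx, coe_two_mul_measure, measureReal_Ioc_of_le hx.le]
    · simp
    · refine measure_ne_top_of_subset (fun y hy => ?_) h
      simpa [hx.le] using ⟨hy.1.le, hy.2⟩
  · rw [doublePrimitive_of_nonneg hx, coe_two_mul_measure, measureReal_Ioc_of_le hx]
    · simp
    · refine measure_ne_top_of_subset (fun y hy => ?_) h
      simpa [hx] using ⟨hy.1.le, hy.2⟩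

theorem measureReal_Ioc_add {a b c : ℝ} (hab : a ≤ b) (hbc : b ≤ c) (h : μ (Icc a c) ≠ ⊤) :
    μ.real (Ioc a b) + μ.real (Ioc b c) = μ.real (Ioc a c) := by
  rw [← Ioc_union_Ioc_eq_Ioc hab hbc, measureReal_union (Ioc_disjoint_Ioc_of_le le_rfl)
    measurableSet_Ioc
    (measure_ne_top_of_subset (Ioc_subset_Icc_self.trans (Icc_subset_Icc_right hbc)) h)
    (measure_ne_top_of_subset (Ioc_subset_Icc_self.trans (Icc_subset_Icc_left hab)) h)]

theorem doublePrimitive_sub {s t : ℝ} (hst : s ≤ t) (h : μ (Icc (min s 0) (max t 0)) ≠ ⊤) :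
    doublePrimitive μ t - doublePrimitive μ s = ((2 * μ (Ioc s t) : ℝ≥0∞) : EReal) := by
  have sub : ∀ {a b : ℝ}, min s 0 ≤ a → b ≤ max t 0 → μ (Icc a b) ≠ ⊤ := fun ha hb =>
    measure_ne_top_of_subset (Icc_subset_Icc ha hb) h
  rw [doublePrimitive_eq_coe (sub (min_le_min_right 0 hst) le_rfl),
    doublePrimitive_eq_coe (sub le_rfl (max_le_max_right 0 hst)), coe_two_mul_measure
      (measure_ne_top_of_subset Ioc_subset_Icc_self (sub (min_le_left _ _) (le_max_left _ _))),
    ← EReal.coe_sub, EReal.coe_eq_coe_iff]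
  rcases le_total s 0 with hs | hs
  · rcases le_total t 0 with ht | ht
    · rw [measureReal_Ioc_of_le hs, measureReal_Ioc_of_le ht]
      have := measureReal_Ioc_add (μ := μ) hst ht (sub (min_le_left _ _) (le_max_right _ _))
      linarith
    · rw [measureReal_Ioc_of_le hs, measureReal_Ioc_of_le ht]
      have := measureReal_Ioc_add (μ := μ) hs ht (sub (min_le_left _ _) (le_max_left _ _))
      linarith
  · rw [measureReal_Ioc_of_le hs, measureReal_Ioc_of_le (hs.trans hst)]
    have := measureReal_Ioc_add (μ := μ) hs hst (sub (min_le_right _ _) (le_max_left _ _))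
    linarith

theorem tendsto_measure_Ioc_nhdsGT_left (μ : Measure ℝ) (x b : ℝ) :
    Tendsto (fun y => μ (Ioc y b)) (𝓝[>] x) (𝓝 (μ (Ioc x b))) := by
  have anti : Antitone fun y => μ (Ioc y b) := fun y z hyz =>
    measure_mono (Ioc_subset_Ioc_left hyz)
  obtain ⟨u, hu_anti, hu_gt, hu_lim⟩ := exists_seq_strictAnti_tendsto x
  have hu : Tendsto u atTop (𝓝[>] x) :=
    tendsto_nhdsWithin_iff.2 ⟨hu_lim, Eventually.of_forall hu_gt⟩
  have key : Tendsto (fun n => μ (Ioc (u n) b)) atTop (𝓝 (μ (⋃ n, Ioc (u n) b))) :=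
    tendsto_measure_iUnion_atTop fun i j hij => Ioc_subset_Ioc_left (hu_anti.antitone hij)
  have hunion : ⋃ n, Ioc (u n) b = Ioc x b := by
    ext y
    simp only [mem_iUnion, mem_Ioc]
    refine ⟨fun ⟨n, h⟩ => ⟨(hu_gt n).trans h.1, h.2⟩, fun h => ?_⟩
    obtain ⟨n, hn⟩ := (hu_lim.eventually_lt_const h.1).exists
    exact ⟨n, hn, h.2⟩
  rw [hunion] at key
  have lim := anti.tendsto_nhdsGT x
  rwa [tendsto_nhds_unique (lim.comp hu) key] at lim

theorem tendsto_measure_Ioc_nhdsGT_right {a x : ℝ} (h : ∃ y > x, μ (Ioc a y) ≠ ⊤) :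
    Tendsto (fun y => μ (Ioc a y)) (𝓝[>] x) (𝓝 (μ (Ioc a x))) := by
  have hinter : ⋂ y > x, Ioc a y = Ioc a x := by
    ext z
    simp only [mem_iInter, mem_Ioc]
    refine ⟨fun hz => ⟨(hz _ (lt_add_one x)).1, le_of_forall_gt_imp_ge_of_dense
      fun y hy => (hz y hy).2⟩, fun hz y hy => ⟨hz.1, hz.2.trans hy.le⟩⟩
  rw [← hinter]
  exact tendsto_measure_biInter_gt (fun _ _ => measurableSet_Ioc.nullMeasurableSet)
    (fun _ _ _ hij => Ioc_subset_Ioc_right hij) h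

theorem tendsto_coe_two_mul {α : Type*} {f : α → ℝ≥0∞} {c : ℝ≥0∞} {F : Filter α}
    (h : Tendsto f F (𝓝 c)) :
    Tendsto (fun a => ((2 * f a : ℝ≥0∞) : EReal)) F (𝓝 ((2 * c : ℝ≥0∞) : EReal)) :=
  (continuous_coe_ennreal_ereal.tendsto _).comp
    (ENNReal.Tendsto.const_mul h (Or.inr (by simp)))

theorem continuousWithinAt_doublePrimitive {x : ℝ}
    (h : 0 ≤ x → ∃ y > x, μ (Ioc 0 y) ≠ ⊤) :
    ContinuousWithinAt (doublePrimitive μ) (Ici x) x := by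
  rw [← continuousWithinAt_Ioi_iff_Ici, ContinuousWithinAt]
  rcases lt_or_ge x 0 with hx | hx
  · rw [doublePrimitive_of_neg hx]
    refine ((continuous_neg.tendsto _).comp
      (tendsto_coe_two_mul (tendsto_measure_Ioc_nhdsGT_left μ x 0))).congr' ?_
    filter_upwards [nhdsWithin_le_nhds (eventually_lt_nhds hx)] with y hy
    exact (doublePrimitive_of_neg hy).symm
  · rw [doublePrimitive_of_nonneg hx]
    refine (tendsto_coe_two_mul (tendsto_measure_Ioc_nhdsGT_right (h hx))).congr' ?_
    filter_upwards [self_mem_nhdsWithin] with y hy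
    exact (doublePrimitive_of_nonneg (hx.trans (le_of_lt hy))).symm

end Primitive

section Ends

variable {E : Set ℝ} {l r : EReal}

theorem IsPastLeftEnd.mono {x y : ℝ} (h : IsPastLeftEnd E l x) (hxy : x ≤ y) :
    IsPastLeftEnd E l y :=
  h.imp_left fun h => h.trans_le (EReal.coe_le_coe_iff.2 hxy)

theorem IsBeforeRightEnd.mono {x y : ℝ} (h : IsBeforeRightEnd E r y) (hxy : x ≤ y) :
    IsBeforeRightEnd E r x :=
  h.imp_left fun h => (EReal.coe_le_coe_iff.2 hxy).trans_lt h

theorem IsPastLeftEnd.exists_lt {x : ℝ} (h : IsPastLeftEnd E l x) :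
    ∃ y < x, IsPastLeftEnd E l y := by
  rcases h with h | h
  · obtain ⟨y, hly, hyx⟩ := EReal.lt_iff_exists_real_btwn.1 h
    exact ⟨y, EReal.coe_lt_coe_iff.1 hyx, Or.inl hly⟩
  · exact ⟨x - 1, sub_one_lt x, Or.inr h⟩

theorem IsBeforeRightEnd.exists_gt {x : ℝ} (h : IsBeforeRightEnd E r x) :
    ∃ y > x, IsBeforeRightEnd E r y := by
  rcases h with h | h
  · obtain ⟨y, hxy, hyr⟩ := EReal.lt_iff_exists_real_btwn.1 h
    exact ⟨y, EReal.coe_lt_coe_iff.1 hxy, Or.inl hyr⟩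
  · exact ⟨x + 1, lt_add_one x, Or.inr h⟩

theorem isPastLeftEnd_of_mem {x : ℝ} (hx : x ∈ E) (hlx : l ≤ x) : IsPastLeftEnd E l x :=
  hlx.lt_or_eq.imp_right fun h => ⟨x, hx, h.symm⟩

theorem isBeforeRightEnd_of_mem {x : ℝ} (hx : x ∈ E) (hxr : x ≤ r) : IsBeforeRightEnd E r x :=
  hxr.lt_or_eq.imp_right fun h => ⟨x, hx, h⟩

/-- A nearly closed set has compact intersection with intervals that avoid its missing ends. -/
theorem isCompact_inter_Icc_of_nearlyClosed
    (hclosed : IsClosed (((fun x : ℝ => (x : EReal)) '' E) ∪ {l, r})) {a b : ℝ}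
    (ha : IsPastLeftEnd E l a) (hb : IsBeforeRightEnd E r b) : IsCompact (E ∩ Icc a b) := by
  have hEq : E ∩ Icc a b =
      (fun x : ℝ => (x : EReal)) ⁻¹' (((fun x : ℝ => (x : EReal)) '' E) ∪ {l, r}) ∩ Icc a b := by
    refine Subset.antisymm (inter_subset_inter_left _ fun x hx => Or.inl ⟨x, hx, rfl⟩) ?_
    rintro x ⟨⟨y, hy, hyx⟩ | hx | hx, hab⟩
    · exact ⟨EReal.coe_injective hyx ▸ hy, hab⟩
    · rcases ha.mono hab.1 with h | ⟨e, he, hel⟩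
      · exact absurd hx h.ne'
      · exact ⟨EReal.coe_injective (hel.trans (Eq.symm hx)) ▸ he, hab⟩
    · rcases hb.mono hab.2 with h | ⟨e, he, hel⟩
      · exact absurd hx h.ne
      · exact ⟨EReal.coe_injective (hel.trans (Eq.symm hx)) ▸ he, hab⟩
  rw [hEq, inter_comm]
  exact isCompact_Icc.inter_right (hclosed.preimage continuous_coe_real_ereal)

theorem exists_Ioc_inter_eq_empty_of_nearlyClosed
    (hclosed : IsClosed (((fun x : ℝ => (x : EReal)) '' E) ∪ {l, r})) {x : ℝ}
    (hlx : l ≠ x) (hxr : x ≠ r) (hx : x ∉ E) :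
    ∃ ε > 0, Ioc (x - ε) (x + ε) ∩ E = ∅ := by
  have hmem : (fun y : ℝ => (y : EReal)) ⁻¹' (((fun x : ℝ => (x : EReal)) '' E) ∪ {l, r})ᶜ ∈
      𝓝 x := by
    refine (hclosed.isOpen_compl.preimage continuous_coe_real_ereal).mem_nhds ?_
    rintro (⟨y, hy, hyx⟩ | h | h)
    · exact hx (EReal.coe_injective hyx ▸ hy)
    · exact hlx (Eq.symm h)
    · exact hxr h
  obtain ⟨ε, hε, hball⟩ := (nhds_basis_Icc_pos x).mem_iff.1 hmem
  refine ⟨ε, hε, eq_empty_of_forall_notMem fun y hy => ?_⟩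
  exact hball (Ioc_subset_Icc_self hy.1) (Or.inl ⟨y, hy.2, rfl⟩)

theorem measure_Icc_ne_top_of_nearlyClosed {μ : Measure ℝ}
    (hclosed : IsClosed (((fun x : ℝ => (x : EReal)) '' E) ∪ {l, r})) (hconc : μ Eᶜ = 0)
    (hfin : ∀ K : Set ℝ, K ⊆ E → IsCompact K → μ K < ⊤) {a b : ℝ}
    (ha : IsPastLeftEnd E l a) (hb : IsBeforeRightEnd E r b) : μ (Icc a b) ≠ ⊤ := by
  rw [← measure_inter_conull hconc, inter_comm]
  exact (hfin _ inter_subset_left (isCompact_inter_Icc_of_nearlyClosed hclosed ha hb)).ne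

theorem EReal.eq_of_forall_lt_coe_iff {a b : EReal} (h : ∀ x : ℝ, a < x ↔ b < x) : a = b := by
  refine le_antisymm (le_of_not_gt fun hab => ?_) (le_of_not_gt fun hab => ?_) <;>
    obtain ⟨x, h₁, h₂⟩ := EReal.lt_iff_exists_real_btwn.1 hab
  · exact h₂.not_gt ((h x).2 h₁)
  · exact h₂.not_gt ((h x).1 h₁)

theorem EReal.eq_of_forall_coe_lt_iff {a b : EReal} (h : ∀ x : ℝ, x < a ↔ x < b) : a = b := by
  refine le_antisymm (le_of_not_gt fun hab => ?_) (le_of_not_gt fun hab => ?_) <;>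
    obtain ⟨x, h₁, h₂⟩ := EReal.lt_iff_exists_real_btwn.1 hab
  · exact h₁.not_gt ((h x).1 h₂)
  · exact h₁.not_gt ((h x).2 h₂)

theorem eq_of_forall_lt_iff_isPastLeftEnd {l₀ : EReal}
    (h : ∀ x : ℝ, l₀ < x ↔ IsPastLeftEnd E l x) (hne : l₀ ≠ ⊥) : l₀ = l := by
  by_cases hatt : ∃ e ∈ E, (e : EReal) = l
  · exact absurd (EReal.eq_of_forall_lt_coe_iff fun x =>
      iff_of_true ((h x).2 (Or.inr hatt)) (EReal.bot_lt_coe x)) hne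
  · exact EReal.eq_of_forall_lt_coe_iff fun x => (h x).trans (or_iff_left hatt)

theorem eq_of_forall_lt_iff_isBeforeRightEnd {r₀ : EReal}
    (h : ∀ x : ℝ, x < r₀ ↔ IsBeforeRightEnd E r x) (hne : r₀ ≠ ⊤) : r₀ = r := by
  by_cases hatt : ∃ e ∈ E, (e : EReal) = r
  · exact absurd (EReal.eq_of_forall_coe_lt_iff fun x =>
      iff_of_true ((h x).2 (Or.inr hatt)) (EReal.coe_lt_top x)) hne
  · exact EReal.eq_of_forall_coe_lt_iff fun x => (h x).trans (or_iff_left hatt)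

end Ends

end

/-- Let `E` be a nearly closed subset of `ℝ` ended by `l` and `r`
with `l < 0 < r`, and `μ` a Borel measure concentrated on `E`, finite on compact
subsets of `E` and with support `E`.  Define `m : ℝ → [-∞,∞]` by
`m x = 2 μ((0,x])` on `[0,r)`, `m x = -2 μ((x,0])` on `[max(l,-∞), 0)`, together
with the boundary prescriptions: for `r < ∞`, `m ≡ ∞` on `[r,∞)` if `r ∉ E` and
`m ≡ 2 μ((0,r])` on `[r,∞)` if `r ∈ E`; for `l > -∞`, `m ≡ -∞` on `(-∞,l)` if
`l ∉ E` and `m ≡ -2 μ([l,0])` on `(-∞,l)` if `l ∈ E`.  Then `m` is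
right-continuous, nondecreasing and non-constant, and with
`l₀ := inf {x : m x > -∞}`, `r₀ := sup {x : m x < ∞}`:
(i) `l₀ > -∞ → l₀ = l` and `r₀ < ∞ → r₀ = r`;
(ii) `E_m := {x ∈ [l,r] ∩ (l₀,r₀) : ∀ ε > 0, m (x-ε) < m (x+ε)}` equals `E`;
(iii) the Lebesgue–Stieltjes measure of `m` restricted to `E` equals `2μ`, i.e.
`m t - m s = 2 μ((s,t])` for all `l₀ < s ≤ t < r₀` (recall `μ` is concentrated
on `E`). -/
theorem stmt_6
    (E : Set ℝ) (l r : EReal)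
    (hl : l = sInf ((fun x : ℝ => (x : EReal)) '' E))
    (hr : r = sSup ((fun x : ℝ => (x : EReal)) '' E))
    (hclosed : IsClosed (((fun x : ℝ => (x : EReal)) '' E) ∪ {l, r}))
    (hl0 : l < (0 : EReal)) (hr0 : (0 : EReal) < r)
    (μ : Measure ℝ)
    (hconc : μ Eᶜ = 0)
    (hfin : ∀ K : Set ℝ, K ⊆ E → IsCompact K → μ K < ⊤)
    (hsupp : ∀ U : Set ℝ, IsOpen U → (U ∩ E).Nonempty → 0 < μ U)
    (m : ℝ → EReal)
    (hm0 : ∀ x : ℝ, 0 ≤ x → (x : EReal) < r →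
      m x = ((2 * μ (Set.Ioc 0 x) : ℝ≥0∞) : EReal))
    (hm1 : ∀ x : ℝ, x < 0 → l ≤ (x : EReal) →
      m x = -((2 * μ (Set.Ioc x 0) : ℝ≥0∞) : EReal))
    (hmr1 : ∀ rr : ℝ, r = (rr : EReal) → rr ∉ E → ∀ x : ℝ, rr ≤ x → m x = ⊤)
    (hmr2 : ∀ rr : ℝ, r = (rr : EReal) → rr ∈ E → ∀ x : ℝ, rr ≤ x →
      m x = ((2 * μ (Set.Ioc 0 rr) : ℝ≥0∞) : EReal))
    (hml1 : ∀ ll : ℝ, l = (ll : EReal) → ll ∉ E → ∀ x : ℝ, x < ll → m x = ⊥)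
    (hml2 : ∀ ll : ℝ, l = (ll : EReal) → ll ∈ E → ∀ x : ℝ, x < ll →
      m x = -((2 * μ (Set.Icc ll 0) : ℝ≥0∞) : EReal))
    (l₀ r₀ : EReal)
    (hl₀ : l₀ = sInf ((fun x : ℝ => (x : EReal)) '' {x : ℝ | ⊥ < m x}))
    (hr₀ : r₀ = sSup ((fun x : ℝ => (x : EReal)) '' {x : ℝ | m x < ⊤})) :
    Monotone m ∧
    (∀ x : ℝ, ContinuousWithinAt m (Set.Ici x) x) ∧
    (¬ ∃ c : EReal, ∀ x : ℝ, m x = c) ∧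
    (l₀ ≠ ⊥ → l₀ = l) ∧ (r₀ ≠ ⊤ → r₀ = r) ∧
    {x : ℝ | l ≤ (x : EReal) ∧ (x : EReal) ≤ r ∧ l₀ < (x : EReal) ∧
      (x : EReal) < r₀ ∧ ∀ ε : ℝ, 0 < ε → m (x - ε) < m (x + ε)} = E ∧
    (∀ s t : ℝ, l₀ < (s : EReal) → (t : EReal) < r₀ → s ≤ t →
      m t - m s = ((2 * μ (Set.Ioc s t) : ℝ≥0∞) : EReal)) := by
  have hlE : ∀ e ∈ E, l ≤ (e : EReal) := fun e he => hl ▸ sInf_le ⟨e, he, rfl⟩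
  have hrE : ∀ e ∈ E, (e : EReal) ≤ r := fun e he => hr ▸ le_sSup ⟨e, he, rfl⟩
  have hleft : ∀ x : ℝ, 0 ≤ x → IsPastLeftEnd E l x := fun x hx =>
    Or.inl (hl0.trans_le (EReal.coe_nonneg.2 hx))
  have hright : ∀ x : ℝ, x ≤ 0 → IsBeforeRightEnd E r x := fun x hx =>
    Or.inl ((EReal.coe_nonpos.2 hx).trans_lt hr0)
  have hIcc : ∀ a b : ℝ, IsPastLeftEnd E l a → IsBeforeRightEnd E r b → μ (Set.Icc a b) ≠ ⊤ :=
    fun a b ha hb => measure_Icc_ne_top_of_nearlyClosed hclosed hconc hfin ha hb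
  have hIcc' : ∀ s t : ℝ, IsPastLeftEnd E l s → IsBeforeRightEnd E r t →
      μ (Set.Icc (min s 0) (max t 0)) ≠ ⊤ := by
    intro s t hs ht
    refine hIcc _ _ ?_ ?_
    · rcases min_choice s 0 with h | h <;> rw [h]
      exacts [hs, hleft 0 le_rfl]
    · rcases max_choice t 0 with h | h <;> rw [h]
      exacts [ht, hright 0 le_rfl]
  have htop : ∀ x : ℝ, ¬ IsBeforeRightEnd E r x → m x = ⊤ := by
    intro x hx
    obtain ⟨hrx, hatt⟩ := not_or.1 hx
    rw [not_lt] at hrx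
    lift r to ℝ using ⟨(hrx.trans_lt (EReal.coe_lt_top x)).ne, (bot_le.trans_lt hr0).ne'⟩
    exact hmr1 r rfl (fun h => hatt ⟨r, h, rfl⟩) x (EReal.coe_le_coe_iff.1 hrx)
  have hbot : ∀ x : ℝ, (x : EReal) < l → ¬ IsPastLeftEnd E l x → m x = ⊥ := by
    intro x hxl hx
    obtain ⟨-, hatt⟩ := not_or.1 hx
    lift l to ℝ using ⟨(hl0.trans_le le_top).ne, ((EReal.bot_lt_coe x).trans hxl).ne'⟩
    exact hml1 l rfl (fun h => hatt ⟨l, h, rfl⟩) x (EReal.coe_lt_coe_iff.1 hxl)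
  have hnonneg : ∀ x : ℝ, 0 ≤ x → IsBeforeRightEnd E r x → m x = doublePrimitive μ x := by
    intro x hx0 hx
    rw [doublePrimitive_of_nonneg hx0]
    rcases lt_or_ge (x : EReal) r with hxr | hrx
    · exact hm0 x hx0 hxr
    · obtain ⟨e, he, rfl⟩ := hx.resolve_left hrx.not_gt
      rw [hmr2 e rfl he x (EReal.coe_le_coe_iff.1 hrx),
        ← measure_inter_conull (s := Set.Ioc 0 e) hconc,
        ← measure_inter_conull (s := Set.Ioc 0 x) hconc]
      congr 3
      ext y
      simp only [Set.mem_inter_iff, Set.mem_Ioc, and_congr_left_iff, and_congr_right_iff]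
      exact fun hy _ => iff_of_true (EReal.coe_le_coe_iff.1 (hrE y hy))
        (EReal.coe_le_coe_iff.1 ((hrE y hy).trans hrx))
  have hneg : ∀ x : ℝ, x < 0 → ¬ ((x : EReal) < l ∧ ¬ IsPastLeftEnd E l x) →
      m x = doublePrimitive μ x := by
    intro x hx0 hx
    rw [doublePrimitive_of_neg hx0]
    rcases le_or_gt l (x : EReal) with hlx | hxl
    · exact hm1 x hx0 hlx
    · obtain ⟨e, he, rfl⟩ := (not_not.1 fun h => hx ⟨hxl, h⟩).resolve_left hxl.not_gt
      rw [hml2 e rfl he x (EReal.coe_lt_coe_iff.1 hxl),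
        ← measure_inter_conull (s := Set.Icc e 0) hconc,
        ← measure_inter_conull (s := Set.Ioc x 0) hconc]
      congr 4
      ext y
      simp only [Set.mem_inter_iff, Set.mem_Ioc, Set.mem_Icc, and_congr_left_iff]
      exact fun hy _ => iff_of_true (EReal.coe_le_coe_iff.1 (hlE y hy))
        (EReal.coe_lt_coe_iff.1 (hxl.trans_le (hlE y hy)))
  have hprim : ∀ x : ℝ, ¬ ((x : EReal) < l ∧ ¬ IsPastLeftEnd E l x) →
      IsBeforeRightEnd E r x → m x = doublePrimitive μ x := fun x hxl hxr =>
    (lt_or_ge x 0).elim (fun h => hneg x h hxl) fun h => hnonneg x h hxr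
  have hprim' : ∀ x : ℝ, IsPastLeftEnd E l x → IsBeforeRightEnd E r x →
      m x = doublePrimitive μ x := fun x hxl => hprim x fun h => h.2 hxl
  have hlt_top : ∀ x : ℝ, m x < ⊤ ↔ IsBeforeRightEnd E r x := by
    refine fun x => ⟨fun h => by_contra fun hx => h.ne (htop x hx), fun hx => ?_⟩
    by_cases hxl : (x : EReal) < l ∧ ¬ IsPastLeftEnd E l x
    · rw [hbot x hxl.1 hxl.2]
      exact bot_lt_top
    rw [hprim x hxl hx]
    rcases lt_or_ge x 0 with hx0 | hx0
    · exact (doublePrimitive_nonpos hx0).trans_lt EReal.zero_lt_top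
    · rw [doublePrimitive_eq_coe (hIcc' x x (hleft x hx0) hx)]
      exact EReal.coe_lt_top _
  have hbot_lt : ∀ x : ℝ, IsPastLeftEnd E l x → ⊥ < m x := by
    intro x hx
    by_cases hxr : IsBeforeRightEnd E r x
    · rw [hprim' x hx hxr, doublePrimitive_eq_coe (hIcc' x x hx hxr)]
      exact EReal.bot_lt_coe _
    · rw [htop x hxr]
      exact bot_lt_top
  have hl₀_iff : ∀ x : ℝ, l₀ < (x : EReal) ↔ IsPastLeftEnd E l x := by
    intro x
    rw [hl₀, sInf_lt_iff]
    constructor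
    · rintro ⟨_, ⟨y, hy, rfl⟩, hyx⟩
      by_contra hx
      refine hy.ne' (hbot y (hyx.trans_le (not_lt.1 fun h => hx (Or.inl h))) fun h => hx ?_)
      exact h.mono (EReal.coe_lt_coe_iff.1 hyx).le
    · intro hx
      obtain ⟨y, hyx, hy⟩ := hx.exists_lt
      exact ⟨y, ⟨y, hbot_lt y hy, rfl⟩, EReal.coe_lt_coe_iff.2 hyx⟩
  have hr₀_iff : ∀ x : ℝ, (x : EReal) < r₀ ↔ IsBeforeRightEnd E r x := by
    intro x
    rw [hr₀, lt_sSup_iff]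
    constructor
    · rintro ⟨_, ⟨y, hy, rfl⟩, hxy⟩
      exact ((hlt_top y).1 hy).mono (EReal.coe_lt_coe_iff.1 hxy).le
    · intro hx
      obtain ⟨y, hxy, hy⟩ := hx.exists_gt
      exact ⟨y, ⟨y, (hlt_top y).2 hy, rfl⟩, EReal.coe_lt_coe_iff.2 hxy⟩
  have hmono : Monotone m := by
    intro s t hst
    by_cases ht : IsBeforeRightEnd E r t
    · by_cases hs : (s : EReal) < l ∧ ¬ IsPastLeftEnd E l s
      · rw [hbot s hs.1 hs.2]
        exact bot_le
      · rw [hprim s hs (ht.mono hst), hprim t (fun h => hs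
          ⟨(EReal.coe_le_coe_iff.2 hst).trans_lt h.1, fun h' => h.2 (h'.mono hst)⟩) ht]
        exact monotone_doublePrimitive hst
    · rw [htop t ht]
      exact le_top
  have hsub : ∀ s t : ℝ, IsPastLeftEnd E l s → IsBeforeRightEnd E r t → s ≤ t →
      m t - m s = ((2 * μ (Set.Ioc s t) : ℝ≥0∞) : EReal) := by
    intro s t hs ht hst
    rw [hprim' t (hs.mono hst) ht, hprim' s hs (ht.mono hst)]
    exact doublePrimitive_sub hst (hIcc' s t hs ht)
  have hlt : ∀ s x t : ℝ, x ∈ E → s < x → x < t → m s < m t := by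
    intro s x t hxE hsx hxt
    obtain ⟨a, hax, ha⟩ := (isPastLeftEnd_of_mem hxE (hlE x hxE)).exists_lt
    obtain ⟨b, hxb, hb⟩ := (isBeforeRightEnd_of_mem hxE (hrE x hxE)).exists_gt
    have hs' := ha.mono (le_max_right s a)
    have ht' := hb.mono (min_le_right t b)
    have hs'x : max s a < x := max_lt hsx hax
    have hxt' : x < min t b := lt_min hxt hxb
    refine (hmono (le_max_left s a)).trans_lt (lt_of_lt_of_le ?_ (hmono (min_le_left t b)))
    have hpos : 0 < μ (Set.Ioc (max s a) (min t b)) :=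
      (hsupp _ isOpen_Ioo ⟨x, ⟨hs'x, hxt'⟩, hxE⟩).trans_le
        (measure_mono Set.Ioo_subset_Ioc_self)
    rw [← EReal.sub_pos, hsub _ _ hs' ht' (hs'x.trans hxt').le, EReal.coe_ennreal_pos]
    exact ENNReal.mul_pos two_ne_zero hpos.ne'
  refine ⟨hmono, fun x => ?_, ?_, eq_of_forall_lt_iff_isPastLeftEnd hl₀_iff,
    eq_of_forall_lt_iff_isBeforeRightEnd hr₀_iff, ?_, fun s t hs ht hst =>
      hsub s t ((hl₀_iff s).1 hs) ((hr₀_iff t).1 ht) hst⟩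
  · by_cases hxr : IsBeforeRightEnd E r x
    · obtain ⟨y, hxy, hy⟩ := hxr.exists_gt
      have hev : ∀ᶠ z in nhdsWithin x (Set.Ici x), z < y :=
        nhdsWithin_le_nhds (eventually_lt_nhds hxy)
      by_cases hxl : (x : EReal) < l ∧ ¬ IsPastLeftEnd E l x
      · have hevl : ∀ᶠ z : ℝ in nhdsWithin x (Set.Ici x), (z : EReal) < l :=
          nhdsWithin_le_nhds (continuous_coe_real_ereal.continuousAt.eventually_lt_const hxl.1)
        refine (continuousWithinAt_const (b := (⊥ : EReal))).congr_of_eventuallyEq ?_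
          (hbot x hxl.1 hxl.2)
        filter_upwards [hevl] with z hz
        exact hbot z hz fun h => hxl.2 (Or.inr (h.resolve_left hz.not_gt))
      · refine (continuousWithinAt_doublePrimitive fun hx0 => ⟨y, hxy, ?_⟩).congr_of_eventuallyEq
          ?_ (hprim x hxl hxr)
        · exact measure_ne_top_of_subset Set.Ioc_subset_Icc_self (hIcc 0 y (hleft 0 le_rfl) hy)
        · filter_upwards [hev, self_mem_nhdsWithin] with z hzy hxz
          exact hprim z (fun h => hxl ⟨(EReal.coe_le_coe_iff.2 hxz).trans_lt h.1,
            fun h' => h.2 (h'.mono hxz)⟩) (hy.mono hzy.le)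
    · exact (continuousWithinAt_const (b := (⊤ : EReal))).congr
        (fun z hz => htop z fun h => hxr (h.mono hz)) (htop x hxr)
  · rintro ⟨c, hc⟩
    rw [hr] at hr0
    obtain ⟨_, ⟨e, he, rfl⟩, -⟩ := lt_sSup_iff.1 hr0
    have := hlt (e - 1) e (e + 1) he (sub_one_lt e) (lt_add_one e)
    rw [hc, hc] at this
    exact this.false
  · ext x
    simp only [Set.mem_ofPred_eq, hl₀_iff, hr₀_iff]
    constructor
    · rintro ⟨-, -, hxl', hxr', hinc⟩
      by_contra hxE
      have hne_l : l ≠ x := by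
        rintro rfl
        obtain ⟨e, he, hex⟩ := hxl'.resolve_left (lt_irrefl _)
        exact hxE (EReal.coe_injective hex ▸ he)
      have hne_r : (x : EReal) ≠ r := by
        rintro rfl
        obtain ⟨e, he, hex⟩ := hxr'.resolve_left (lt_irrefl _)
        exact hxE (EReal.coe_injective hex ▸ he)
      obtain ⟨ε, hε, hempty⟩ :=
        exists_Ioc_inter_eq_empty_of_nearlyClosed hclosed hne_l hne_r hxE
      obtain ⟨a, hax, ha⟩ := hxl'.exists_lt
      obtain ⟨b, hxb, hb⟩ := hxr'.exists_gt
      obtain ⟨δ, hδ, hδε, hδa, hδb⟩ : ∃ δ > 0, δ ≤ ε ∧ δ ≤ x - a ∧ δ ≤ b - x :=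
        ⟨min ε (min (x - a) (b - x)), lt_min hε (lt_min (sub_pos.2 hax) (sub_pos.2 hxb)),
          min_le_left _ _, (min_le_right _ _).trans (min_le_left _ _),
          (min_le_right _ _).trans (min_le_right _ _)⟩
      have hnull : μ (Set.Ioc (x - δ) (x + δ)) = 0 := by
        have hcompl : Set.Ioc (x - δ) (x + δ) ⊆ Eᶜ := fun y hy hyE =>
          Set.eq_empty_iff_forall_notMem.1 hempty y
            ⟨Set.Ioc_subset_Ioc (by linarith) (by linarith) hy, hyE⟩
        exact measure_mono_null hcompl hconc
      have hpos := EReal.sub_pos.2 (hinc δ hδ)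
      rw [hsub _ _ (ha.mono (by linarith)) (hb.mono (by linarith)) (by linarith), hnull] at hpos
      simp at hpos
    · exact fun hx => ⟨hlE x hx, hrE x hx, isPastLeftEnd_of_mem hx (hlE x hx),
        isBeforeRightEnd_of_mem hx (hrE x hx), fun ε hε =>
          hlt _ x _ hx (sub_lt_self x hε) (lt_add_of_pos_right x hε)⟩
end

section
/- Let E be a nearly closed subset of the extended reals ended by l and r, and let s : E → ℝ be a strictly increasing, continuous (with respect to the subspace topology) real-valued function. Then s(E) := {s(x) : x ∈ E} is a nearly closed subset of ℝ; that is, s(E) ⊆ ℝ and s(E) ∪ {inf s(E), sup s(E)} is a closed subset of [-∞,∞]. Moreover, if l ∈ E then inf s(E) = s(l) ∈ s(E) is finite, and if r ∈ E then sup s(E) = s(r) ∈ s(E) is finite. -/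
open Filter Topology in
/-- If `f` is monotone and continuous on `E`, and `E` together with its infimum and supremum is
closed, then so is the image of `E` together with its infimum and supremum. -/
theorem MonotoneOn.isClosed_image_union_sInf_sSup {α β : Type*}
    [CompleteLinearOrder α] [TopologicalSpace α] [OrderTopology α]
    [CompleteLinearOrder β] [TopologicalSpace β] [OrderTopology β]
    {f : α → β} {E : Set α} (hf : MonotoneOn f E) (hcont : ContinuousOn f E)
    (hE : IsClosed (E ∪ {sInf E, sSup E})) :
    IsClosed (f '' E ∪ {sInf (f '' E), sSup (f '' E)}) := by
  refine isClosed_of_closure_subset fun y hy => ?_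
  rw [closure_union, (Set.toFinite {sInf (f '' E), sSup (f '' E)}).isClosed.closure_eq] at hy
  rcases hy with hy | hy
  swap
  · exact Or.inr hy
  have hy_Icc : y ∈ Set.Icc (sInf (f '' E)) (sSup (f '' E)) :=
    isClosed_Icc.closure_subset_iff.2 (fun _ hz => ⟨sInf_le hz, le_sSup hz⟩) hy
  obtain ⟨v, hv, hvy⟩ := mem_closure_iff_ultrafilter.1 hy
  let u := Ultrafilter.ofComapInfPrincipal hv
  have huE : E ∈ u := Ultrafilter.ofComapInfPrincipal_mem hv
  have hfu : Tendsto f u (𝓝 y) := by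
    have h : u.map f = v := Ultrafilter.ofComapInfPrincipal_eq_of_map hv
    rw [← h] at hvy
    exact hvy
  obtain ⟨x, hx, hux⟩ := hE.isCompact.ultrafilter_le_nhds' u
    (mem_of_superset huE Set.subset_union_left)
  by_cases hxE : x ∈ E
  · have h : Tendsto f u (𝓝 (f x)) :=
      (hcont x hxE).mono_left (le_inf hux (le_principal_iff.2 huE))
    exact Or.inl ⟨x, hxE, tendsto_nhds_unique h hfu⟩
  rcases hx with hx | rfl | rfl
  · exact absurd hx hxE
  · refine Or.inr (Or.inl (le_antisymm (le_sInf ?_) hy_Icc.1))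
    rintro _ ⟨e, he, rfl⟩
    have hlt : sInf E < e := (sInf_le he).lt_of_ne fun h => hxE (h ▸ he)
    refine le_of_tendsto hfu ?_
    filter_upwards [huE, hux (Iio_mem_nhds hlt)] with a ha hae
    exact hf ha he (le_of_lt hae)
  · refine Or.inr (Or.inr (le_antisymm hy_Icc.2 (sSup_le ?_)))
    rintro _ ⟨e, he, rfl⟩
    have hlt : e < sSup E := (le_sSup he).lt_of_ne fun h => hxE (h ▸ he)
    refine ge_of_tendsto hfu ?_
    filter_upwards [huE, hux (Ioi_mem_nhds hlt)] with a ha hae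
    exact hf he ha (le_of_lt hae)


/-- Let `E` be a nearly closed subset of `[-∞,∞]` ended by
`l := inf E`, `r := sup E` (i.e. `E ∪ {l,r}` is closed in `[-∞,∞]`), and let
`s : E → ℝ` be strictly increasing and continuous for the subspace topology.
Then `s(E)` is a nearly closed subset of `ℝ`: viewing `s(E) ⊆ ℝ ⊆ [-∞,∞]`,
the set `s(E) ∪ {inf s(E), sup s(E)}` is closed in `[-∞,∞]`.  Moreover, if
`l ∈ E` then `inf s(E) = s l` (a finite value attained in `s(E)`), and if
`r ∈ E` then `sup s(E) = s r` (a finite value attained in `s(E)`). -/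
theorem stmt_8
    (E : Set EReal) (l r : EReal) (hl : l = sInf E) (hr : r = sSup E)
    (hclosed : IsClosed (E ∪ {l, r}))
    (s : EReal → ℝ) (hmono : StrictMonoOn s E) (hcont : ContinuousOn s E)
    (Sc : Set EReal) (hSc : Sc = (fun y : EReal => ((s y : ℝ) : EReal)) '' E) :
    IsClosed (Sc ∪ {sInf Sc, sSup Sc}) ∧
    (l ∈ E → sInf Sc = ((s l : ℝ) : EReal) ∧ ((s l : ℝ) : EReal) ∈ Sc) ∧
    (r ∈ E → sSup Sc = ((s r : ℝ) : EReal) ∧ ((s r : ℝ) : EReal) ∈ Sc) := by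
  subst hl hr hSc
  have hmono' : MonotoneOn (fun y : EReal => ((s y : ℝ) : EReal)) E := fun _ ha _ hb hab =>
    EReal.coe_le_coe_iff.2 (hmono.monotoneOn ha hb hab)
  refine ⟨hmono'.isClosed_image_union_sInf_sSup
    (continuous_coe_real_ereal.comp_continuousOn hcont) hclosed, fun h => ?_, fun h => ?_⟩
  · have hleast : IsLeast E (sInf E) := ⟨h, fun _ => sInf_le⟩
    exact ⟨(hmono'.map_isLeast hleast).isGLB.sInf_eq, Set.mem_image_of_mem _ h⟩
  · have hgreatest : IsGreatest E (sSup E) := ⟨h, fun _ => le_sSup⟩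
    exact ⟨(hmono'.map_isGreatest hgreatest).isLUB.sSup_eq, Set.mem_image_of_mem _ h⟩
end

section
/- Let E be a nearly closed subset of the extended reals ended by l and r, with gaps (a_k, b_k), k ≥ 1 (whose endpoints a_k, b_k lie in E). Let d := {(x,x) : x ∈ E} be the diagonal of E × E, let F := {(a_k,b_k) : k ≥ 1} ∪ {(b_k,a_k) : k ≥ 1} ⊆ E × E, and let G := (E × E ∖ d) ∖ F, an open subset of E × E ∖ d. Let 𝒞 be the set of all finite sums (x,y) ↦ Σ_{i=1}^p u_i(x)·v_i(y), where u_i, v_i : E → ℝ are continuous with compact support, supp u_i ∩ supp v_i = ∅, and u_i(a_k)·v_i(b_k) = u_i(b_k)·v_i(a_k) = 0 for all k ≥ 1 and 1 ≤ i ≤ p. Then 𝒞 is a subalgebra of C_c(G) that separates the points of G and vanishes at no point of G (for each (x,y) ∈ G there is f ∈ 𝒞 with f(x,y) ≠ 0); consequently, 𝒞 is dense in C_c(G) with respect to the uniform norm. -/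
open Set Topology

section DisjointTensorSpan

variable {X : Type*} [TopologicalSpace X]

/-- Two compactly supported functions with disjoint supports whose tensor product vanishes on
`F`. -/
structure IsAdmissiblePair (F : Set (X × X)) (u v : C(X, ℝ)) : Prop where
  compact_left : HasCompactSupport u
  compact_right : HasCompactSupport v
  disjoint : tsupport u ∩ tsupport v = ∅
  eq_zero : ∀ q ∈ F, u q.1 * v q.2 = 0

/-- The finite sums of tensor products of admissible pairs. -/
def disjointTensorSpan (F : Set (X × X)) : AddSubmonoid (X × X → ℝ) :=
  AddSubmonoid.closure {f | ∃ u v : C(X, ℝ), IsAdmissiblePair F u v ∧ f = fun q => u q.1 * v q.2}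

variable {F : Set (X × X)} {f g : X × X → ℝ} {u v : C(X, ℝ)}

theorem IsAdmissiblePair.mem_disjointTensorSpan (h : IsAdmissiblePair F u v) :
    (fun q : X × X => u q.1 * v q.2) ∈ disjointTensorSpan F :=
  AddSubmonoid.subset_closure ⟨u, v, h, rfl⟩

theorem mem_disjointTensorSpan_iff :
    f ∈ disjointTensorSpan F ↔ ∃ (p : ℕ) (u v : ℕ → C(X, ℝ)),
      (∀ i < p, IsAdmissiblePair F (u i) (v i)) ∧
        f = fun q => ∑ i ∈ Finset.range p, u i q.1 * v i q.2 := by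
  constructor
  · intro hf
    induction hf using AddSubmonoid.closure_induction with
    | mem f hf =>
      obtain ⟨u, v, huv, rfl⟩ := hf
      exact ⟨1, fun _ => u, fun _ => v, fun _ _ => huv, by simp⟩
    | zero => exact ⟨0, 0, 0, by simp, by ext; simp⟩
    | add f g _ _ hf hg =>
      obtain ⟨p, u, v, huv, rfl⟩ := hf
      obtain ⟨p', u', v', huv', rfl⟩ := hg
      refine ⟨p + p', fun i => if i < p then u i else u' (i - p),
        fun i => if i < p then v i else v' (i - p), fun i hi => ?_, ?_⟩
      · by_cases h : i < p
        · simpa [h] using huv i h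
        · simpa [h] using huv' (i - p) (by omega)
      · ext q
        simp only [Pi.add_apply, Finset.sum_range_add]
        congr 1
        · refine Finset.sum_congr rfl fun i hi => ?_
          simp [Finset.mem_range.1 hi]
        · simp
  · rintro ⟨p, u, v, huv, rfl⟩
    have : (fun q : X × X => ∑ i ∈ Finset.range p, u i q.1 * v i q.2) =
        ∑ i ∈ Finset.range p, fun q : X × X => u i q.1 * v i q.2 := by
      ext q; simp
    rw [this]
    exact sum_mem fun i hi => (huv i (Finset.mem_range.1 hi)).mem_disjointTensorSpan

theorem continuous_of_mem_disjointTensorSpan (hf : f ∈ disjointTensorSpan F) : Continuous f := by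
  induction hf using AddSubmonoid.closure_induction with
  | mem f hf => obtain ⟨u, v, -, rfl⟩ := hf; fun_prop
  | zero => exact continuous_const
  | add f g _ _ hf hg => exact hf.add hg

theorem hasCompactSupport_of_mem_disjointTensorSpan [R1Space X] (hf : f ∈ disjointTensorSpan F) :
    HasCompactSupport f := by
  induction hf using AddSubmonoid.closure_induction with
  | mem f hf =>
    obtain ⟨u, v, h, rfl⟩ := hf
    refine HasCompactSupport.intro (h.compact_left.isCompact.prod h.compact_right.isCompact)
      fun q hq => ?_
    by_contra hne
    exact hq ⟨subset_tsupport u (left_ne_zero_of_mul hne),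
      subset_tsupport v (right_ne_zero_of_mul hne)⟩
  | zero => exact HasCompactSupport.zero
  | add f g _ _ hf hg => exact hf.add hg

theorem eq_zero_of_mem_disjointTensorSpan (hf : f ∈ disjointTensorSpan F) {q : X × X}
    (hq : q ∉ {p : X × X | p.1 ≠ p.2} \ F) : f q = 0 := by
  induction hf using AddSubmonoid.closure_induction with
  | mem f hf =>
    obtain ⟨u, v, h, rfl⟩ := hf
    by_cases hqF : q ∈ F
    · exact h.eq_zero q hqF
    · have heq : q.1 = q.2 := by
        by_contra hne
        exact hq ⟨hne, hqF⟩
      by_contra hne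
      have : q.2 ∈ tsupport u ∩ tsupport v :=
        ⟨subset_tsupport u (heq ▸ left_ne_zero_of_mul hne),
          subset_tsupport v (right_ne_zero_of_mul hne)⟩
      simp [h.disjoint] at this
  | zero => rfl
  | add f g _ _ hf hg => simp [hf, hg]

theorem IsAdmissiblePair.mul (h : IsAdmissiblePair F u v) (a b : C(X, ℝ)) :
    IsAdmissiblePair F (a * u) (b * v) where
  compact_left := h.compact_left.mul_left
  compact_right := h.compact_right.mul_left
  disjoint := subset_empty_iff.1 <| h.disjoint ▸
    inter_subset_inter (tsupport_mul_subset_right (f := a)) (tsupport_mul_subset_right (f := b))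
  eq_zero q hq := by
    linear_combination (norm := (simp; ring)) a q.1 * b q.2 * h.eq_zero q hq

theorem tensor_mul_mem_disjointTensorSpan (a b : C(X, ℝ)) (hf : f ∈ disjointTensorSpan F) :
    (fun q : X × X => a q.1 * b q.2) * f ∈ disjointTensorSpan F := by
  induction hf using AddSubmonoid.closure_induction with
  | mem f hf =>
    obtain ⟨u, v, h, rfl⟩ := hf
    convert (h.mul a b).mem_disjointTensorSpan using 1
    ext q
    simp
    ring
  | zero => simp
  | add f g _ _ hf hg => simpa [mul_add] using add_mem hf hg

/-- The continuous functions which multiply `disjointTensorSpan F` into itself. -/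
def disjointTensorMultipliers (F : Set (X × X)) : Subalgebra ℝ C(X × X, ℝ) where
  carrier := {h | ∀ f ∈ disjointTensorSpan F, ⇑h * f ∈ disjointTensorSpan F}
  mul_mem' {h k} hh hk f hf := by
    simpa [mul_assoc] using hh _ (hk f hf)
  add_mem' {h k} hh hk f hf := by
    simpa [add_mul] using add_mem (hh f hf) (hk f hf)
  algebraMap_mem' c f hf := by
    convert tensor_mul_mem_disjointTensorSpan (.const X c) (.const X 1) hf using 1
    ext q
    simp

theorem tensor_mem_disjointTensorMultipliers (a b : C(X, ℝ)) :
    (⟨fun q => a q.1 * b q.2, by fun_prop⟩ : C(X × X, ℝ)) ∈ disjointTensorMultipliers F :=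
  fun _ hf => tensor_mul_mem_disjointTensorSpan a b hf

theorem mem_disjointTensorMultipliers_of_mem (hf : f ∈ disjointTensorSpan F) :
    (⟨f, continuous_of_mem_disjointTensorSpan hf⟩ : C(X × X, ℝ)) ∈
      disjointTensorMultipliers F := by
  intro g hg
  change f * g ∈ _
  induction hf using AddSubmonoid.closure_induction with
  | mem f hf =>
    obtain ⟨u, v, -, rfl⟩ := hf
    exact tensor_mul_mem_disjointTensorSpan u v hg
  | zero => simp
  | add f g _ _ hf hg => simpa [add_mul] using add_mem hf hg

theorem mul_mem_disjointTensorSpan (hf : f ∈ disjointTensorSpan F)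
    (hg : g ∈ disjointTensorSpan F) : f * g ∈ disjointTensorSpan F :=
  mem_disjointTensorMultipliers_of_mem hf g hg

theorem smul_mem_disjointTensorSpan (c : ℝ) (hf : f ∈ disjointTensorSpan F) :
    c • f ∈ disjointTensorSpan F := by
  convert (disjointTensorMultipliers F).algebraMap_mem c f hf using 1
  ext q
  simp

variable [T2Space X] [LocallyCompactSpace X]

theorem separatesPoints_disjointTensorMultipliers :
    (disjointTensorMultipliers F).SeparatesPoints := by
  have key : ∀ x y : X, x ≠ y → ∃ a : C(X, ℝ), a x ≠ a y := fun x y hxy => by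
    obtain ⟨a, ha, -, hs, -⟩ := exists_continuousMap_one_of_isCompact_subset_isOpen
      (isCompact_singleton (x := x)) (isOpen_compl_singleton (x := y)) (singleton_subset_iff.2 hxy)
    refine ⟨a, ?_⟩
    rw [ha rfl, image_eq_zero_of_notMem_tsupport fun h => hs h rfl]
    simp
  intro q₁ q₂ hne
  by_cases h : q₁.1 = q₂.1
  · obtain ⟨b, hb⟩ := key q₁.2 q₂.2 fun h' => hne (Prod.ext h h')
    exact ⟨_, ⟨_, tensor_mem_disjointTensorMultipliers 1 b, rfl⟩, by simpa using hb⟩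
  · obtain ⟨a, ha⟩ := key q₁.1 q₂.1 h
    exact ⟨_, ⟨_, tensor_mem_disjointTensorMultipliers a 1, rfl⟩, by simpa using ha⟩

theorem exists_mem_disjointTensorSpan_eq_one {W : Set (X × X)} (hW : IsOpen W)
    (hWF : W ⊆ {p | p.1 ≠ p.2} \ F) {q : X × X} (hq : q ∈ W) :
    ∃ f ∈ disjointTensorSpan F, 0 ≤ f ∧ f q = 1 ∧ ∀ q' ∉ W, f q' = 0 := by
  obtain ⟨U, V, hU, hV, hqU, hqV, hUV⟩ := isOpen_prod_iff.1 hW q.1 q.2 hq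
  obtain ⟨u, hu, huc, hus, hu01⟩ := exists_continuousMap_one_of_isCompact_subset_isOpen
    (isCompact_singleton (x := q.1)) hU (by simpa using hqU)
  obtain ⟨v, hv, hvc, hvs, hv01⟩ := exists_continuousMap_one_of_isCompact_subset_isOpen
    (isCompact_singleton (x := q.2)) hV (by simpa using hqV)
  have hzero : ∀ q' ∉ W, u q'.1 * v q'.2 = 0 := fun q' hq' => by
    by_contra hne
    exact hq' (hUV ⟨hus (subset_tsupport u (left_ne_zero_of_mul hne)),
      hvs (subset_tsupport v (right_ne_zero_of_mul hne))⟩)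
  refine ⟨_, IsAdmissiblePair.mem_disjointTensorSpan (u := u) (v := v)
    ⟨huc, hvc, ?_, fun q' hq' => hzero q' fun h => (hWF h).2 hq'⟩,
    fun q' => mul_nonneg (hu01 _).1 (hv01 _).1, by simp [hu rfl, hv rfl], hzero⟩
  refine eq_empty_of_forall_notMem fun x hx => ?_
  have : (x, x) ∈ W := hUV ⟨hus hx.1, hvs hx.2⟩
  exact (hWF this).1 rfl

theorem exists_mem_disjointTensorSpan_one_le {G : Set (X × X)} (hG : IsOpen G)
    (hGF : G ⊆ {p | p.1 ≠ p.2} \ F) {K : Set (X × X)} (hK : IsCompact K) (hKG : K ⊆ G) :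
    ∃ f ∈ disjointTensorSpan F, 0 ≤ f ∧ ∀ q ∈ K, 1 ≤ f q := by
  refine hK.induction_on (p := fun s => ∃ f ∈ disjointTensorSpan F, 0 ≤ f ∧ ∀ q ∈ s, 1 ≤ f q)
    ⟨0, zero_mem _, le_rfl, by simp⟩ ?_ ?_ fun q hq => ?_
  · rintro s t hst ⟨f, hf, h₀, h₁⟩
    exact ⟨f, hf, h₀, fun q hq => h₁ q (hst hq)⟩
  · rintro s t ⟨f, hf, hf₀, hf₁⟩ ⟨g, hg, hg₀, hg₁⟩
    refine ⟨f + g, add_mem hf hg, add_nonneg hf₀ hg₀, ?_⟩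
    rintro q (hq | hq)
    · exact le_add_of_le_of_nonneg (hf₁ q hq) (hg₀ q)
    · exact le_add_of_nonneg_of_le (hf₀ q) (hg₁ q hq)
  · obtain ⟨f, hf, hf₀, hf₁, -⟩ := exists_mem_disjointTensorSpan_eq_one hG hGF (hKG hq)
    have hcont := continuous_of_mem_disjointTensorSpan (add_mem hf hf)
    refine ⟨{q | 1 < (f + f) q}, mem_nhdsWithin_of_mem_nhds
      ((isOpen_lt continuous_const hcont).mem_nhds ?_), f + f, add_mem hf hf,
      add_nonneg hf₀ hf₀, fun q hq => le_of_lt hq⟩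
    simp [hf₁]

theorem exists_mem_disjointTensorSpan_near {G : Set (X × X)} (hG : IsOpen G)
    (hGF : G ⊆ {p | p.1 ≠ p.2} \ F) (g : C(G, ℝ)) (hg : HasCompactSupport g)
    {ε : ℝ} (hε : 0 < ε) :
    ∃ f ∈ disjointTensorSpan F, ∀ q : G, |f q - g q| < ε := by
  obtain ⟨f₀, hf₀, hf₀_nonneg, hf₀_one⟩ := exists_mem_disjointTensorSpan_one_le hG hGF
    (hg.isCompact.image continuous_subtype_val) (by rintro _ ⟨q, -, rfl⟩; exact q.2)
  have hcont := continuous_of_mem_disjointTensorSpan hf₀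
  have hcomp := hasCompactSupport_of_mem_disjointTensorSpan hf₀
  obtain ⟨M, hM⟩ := hcomp.exists_bound_of_continuous hcont
  have hM₀ : 0 < |M| + 1 := by positivity
  have hext : Continuous (Function.extend ((↑) : G → X × X) g 0) :=
    HasCompactSupport.continuous_extend_zero hG g.continuous hg
  obtain ⟨h, hh, hnear⟩ :=
    ContinuousMap.exists_mem_subalgebra_near_continuous_of_isCompact_of_separatesPoints
      (separatesPoints_disjointTensorMultipliers (F := F))
      ⟨fun q => Function.extend ((↑) : G → X × X) g 0 q / max (f₀ q) 1,
        hext.div (hcont.max continuous_const) fun q => by positivity⟩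
      hcomp.isCompact (div_pos hε hM₀)
  refine ⟨⇑h * f₀, hh f₀ hf₀, fun q => ?_⟩
  have hgq : g q = g q / max (f₀ q) 1 * f₀ q := by
    by_cases hq : q ∈ tsupport g
    · have := hf₀_one q ⟨q, hq, rfl⟩
      rw [max_eq_left this, div_mul_cancel₀]
      positivity
    · simp [image_eq_zero_of_notMem_tsupport hq]
  by_cases hq : (q : X × X) ∈ tsupport f₀
  · have h₁ := hnear q hq
    have h₂ := hM q
    simp only [ContinuousMap.coe_mk, Subtype.val_injective.extend_apply] at h₁
    rw [Pi.mul_apply, hgq, ← sub_mul, abs_mul]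
    calc _ ≤ |h q - g q / max (f₀ q) 1| * (|M| + 1) := by
          gcongr
          exact h₂.trans ((le_abs_self M).trans (by simp))
      _ < ε / (|M| + 1) * (|M| + 1) := by gcongr; exact h₁
      _ = ε := by field_simp
  · rw [Pi.mul_apply, hgq, image_eq_zero_of_notMem_tsupport hq]
    simpa using hε

end DisjointTensorSpan

theorem locallyCompactSpace_of_isClosed_union_finite {Y : Type*} [TopologicalSpace Y] [T1Space Y]
    [LocallyCompactSpace Y] {E s : Set Y} (hs : s.Finite) (h : IsClosed (E ∪ s)) :
    LocallyCompactSpace E := by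
  have : E = (E ∪ s) ∩ (s \ E)ᶜ := by
    ext x
    simp only [mem_inter_iff, mem_union, mem_compl_iff, mem_sdiff]
    tauto
  rw [this]
  exact (h.isLocallyClosed.inter (hs.sdiff.isClosed.isOpen_compl.isLocallyClosed)).locallyCompactSpace

/-- Two points `x < y` of `E` that are not the endpoints of a gap have a point of `E` strictly
between them. -/
theorem exists_separating_of_not_gap {α ι : Type*} [LinearOrder α] [DenselyOrdered α]
    {E : Set α} {l r : α} {a b : ι → α} (hlb : ∀ x ∈ E, l ≤ x) (hub : ∀ x ∈ E, x ≤ r)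
    (ha : ∀ k, a k ∈ E) (hb : ∀ k, b k ∈ E)
    (hgaps : (⋃ k, Ioo (a k) (b k)) = Icc l r \ (E ∪ {l, r}))
    {x y : α} (hx : x ∈ E) (hy : y ∈ E) (hxy : x < y) (hne : ∀ k, ¬(x = a k ∧ y = b k)) :
    ∃ z ∈ E, x < z ∧ z < y := by
  by_contra! hno
  obtain ⟨w, hxw, hwy⟩ := exists_between hxy
  have hgap : ∀ k, ∀ z ∈ E, a k < z → b k ≤ z := fun k z hz hak => by
    by_contra! hzb
    have : z ∈ Icc l r \ (E ∪ {l, r}) := hgaps ▸ mem_iUnion.2 ⟨k, hak, hzb⟩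
    exact this.2 (Or.inl hz)
  have hlw := (hlb x hx).trans_lt hxw
  have hwr := hwy.trans_le (hub y hy)
  have hw : w ∈ ⋃ k, Ioo (a k) (b k) := by
    rw [hgaps]
    refine ⟨⟨hlw.le, hwr.le⟩, ?_⟩
    rintro (hwE | rfl | rfl)
    · exact (hno w hwE hxw).not_gt hwy
    · exact hlw.false
    · exact hwr.false
  obtain ⟨k, hak, hkb⟩ := mem_iUnion.1 hw
  have h₁ : a k ≤ x := by
    by_contra! h
    exact (hno _ (ha k) h).not_gt (hak.trans hwy)
  have h₂ : x ≤ a k := by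
    by_contra! h
    exact (hgap k x hx h).not_gt (hxw.trans hkb)
  have h₃ : y ≤ b k := hno _ (hb k) (hxw.trans hkb)
  have h₄ : b k ≤ y := hgap k y hy (hak.trans hwy)
  exact hne k ⟨le_antisymm h₂ h₁, le_antisymm h₃ h₄⟩

/-- The set of off-diagonal pairs that are not the endpoints of a gap is open. -/
theorem isOpen_offDiag_diff_gaps {α ι : Type*} [LinearOrder α] [DenselyOrdered α]
    [TopologicalSpace α] [OrderTopology α]
    {E : Set α} {l r : α} {a b : ι → α} (hlb : ∀ x ∈ E, l ≤ x) (hub : ∀ x ∈ E, x ≤ r)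
    (ha : ∀ k, a k ∈ E) (hb : ∀ k, b k ∈ E) (hlt : ∀ k, a k < b k)
    (hgaps : (⋃ k, Ioo (a k) (b k)) = Icc l r \ (E ∪ {l, r})) :
    IsOpen ({p : E × E | p.1 ≠ p.2} \ {p : E × E | ∃ k,
      ((p.1 : α) = a k ∧ (p.2 : α) = b k) ∨ ((p.1 : α) = b k ∧ (p.2 : α) = a k)}) := by
  have hgap : ∀ k, ∀ z ∈ E, a k < z → ¬z < b k := fun k z hz hak hzb => by
    have : z ∈ Icc l r \ (E ∪ {l, r}) := hgaps ▸ mem_iUnion.2 ⟨k, hak, hzb⟩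
    exact this.2 (Or.inl hz)
  rw [isOpen_iff_mem_nhds]
  rintro ⟨x, y⟩ ⟨hne, hF⟩
  simp only [mem_ofPred_eq, not_exists, not_or] at hne hF
  rcases lt_or_gt_of_ne (Subtype.coe_ne_coe.2 hne) with hxy | hyx
  · obtain ⟨z, hz, hxz, hzy⟩ := exists_separating_of_not_gap hlb hub ha hb hgaps x.2 y.2 hxy
      fun k => (hF k).1
    filter_upwards [(isOpen_lt (continuous_subtype_val.comp continuous_fst)
        continuous_const).mem_nhds (show ((x, y) : E × E).1.1 < z from hxz),
      (isOpen_lt continuous_const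
        (continuous_subtype_val.comp continuous_snd)).mem_nhds
        (show z < ((x, y) : E × E).2.1 from hzy)]
    rintro ⟨x', y'⟩ (h₁ : x'.1 < z) (h₂ : z < y'.1)
    refine ⟨fun h => (h₁.trans h₂).ne (congrArg Subtype.val h), ?_⟩
    rintro ⟨k, ⟨h₃, h₄⟩ | ⟨h₃, h₄⟩⟩
    · exact hgap k z hz (h₃ ▸ h₁) (h₄ ▸ h₂)
    · exact (h₁.trans h₂).not_gt (h₃ ▸ h₄ ▸ hlt k)
  · obtain ⟨z, hz, hyz, hzx⟩ := exists_separating_of_not_gap hlb hub ha hb hgaps y.2 x.2 hyx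
      fun k h => (hF k).2 h.symm
    filter_upwards [(isOpen_lt (continuous_subtype_val.comp continuous_snd)
        continuous_const).mem_nhds (show ((x, y) : E × E).2.1 < z from hyz),
      (isOpen_lt continuous_const
        (continuous_subtype_val.comp continuous_fst)).mem_nhds
        (show z < ((x, y) : E × E).1.1 from hzx)]
    rintro ⟨x', y'⟩ (h₁ : y'.1 < z) (h₂ : z < x'.1)
    refine ⟨fun h => (h₁.trans h₂).ne (congrArg Subtype.val h).symm, ?_⟩
    rintro ⟨k, ⟨h₃, h₄⟩ | ⟨h₃, h₄⟩⟩
    · exact (h₁.trans h₂).not_gt (h₃ ▸ h₄ ▸ hlt k)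
    · exact hgap k z hz (h₄ ▸ h₁) (h₃ ▸ h₂)

/-- Let `E` be a nearly closed subset of `[-∞,∞]` ended by
`l := inf E`, `r := sup E`, with gaps `(aK k, bK k)` whose endpoints lie in `E`.
With `d` the diagonal of `E × E`, `F := {(aK k, bK k)} ∪ {(bK k, aK k)}` and
`G := (E × E \ d) \ F`, let `𝒞` be the collection of functions
`(x,y) ↦ ∑_{i<p} uᵢ x * vᵢ y` where `uᵢ, vᵢ : E → ℝ` are continuous with compact
support, `supp uᵢ ∩ supp vᵢ = ∅`, and `uᵢ (aK k) * vᵢ (bK k) = uᵢ (bK k) * vᵢ (aK k) = 0`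
for all `k`, `i < p`.  Then `𝒞` is a subalgebra of `C_c(G)` (each member is
continuous, vanishes off `G`, has compact support, and its level sets
`{|f| ≥ ε}` are compact subsets of `G`), `𝒞` separates the points of `G` and
vanishes at no point of `G`; consequently `𝒞` is uniformly dense in `C_c(G)`. -/
theorem stmt_9
    (E : Set EReal) (l r : EReal) (hl : l = sInf E) (hr : r = sSup E)
    (hclosed : IsClosed (E ∪ {l, r}))
    {ι : Type*} [Countable ι] (aK bK : ι → EReal)
    (haK : ∀ k, aK k ∈ E) (hbK : ∀ k, bK k ∈ E) (hlt : ∀ k, aK k < bK k)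
    (hdisj : Pairwise (Function.onFun Disjoint fun k => Set.Ioo (aK k) (bK k)))
    (hgaps : (⋃ k, Set.Ioo (aK k) (bK k)) = Set.Icc l r \ (E ∪ {l, r}))
    (F G : Set (↥E × ↥E))
    (hF : F = {p : ↥E × ↥E | ∃ k,
      ((p.1 : EReal) = aK k ∧ (p.2 : EReal) = bK k) ∨
      ((p.1 : EReal) = bK k ∧ (p.2 : EReal) = aK k)})
    (hG : G = {p : ↥E × ↥E | p.1 ≠ p.2} \ F)
    (𝒞 : Set (↥E × ↥E → ℝ))
    (h𝒞 : 𝒞 = {f : ↥E × ↥E → ℝ | ∃ (p : ℕ) (u v : ℕ → C(↥E, ℝ)),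
      (∀ i < p, HasCompactSupport ⇑(u i) ∧ HasCompactSupport ⇑(v i) ∧
        tsupport ⇑(u i) ∩ tsupport ⇑(v i) = ∅ ∧
        ∀ k : ι, u i ⟨aK k, haK k⟩ * v i ⟨bK k, hbK k⟩ = 0 ∧
          u i ⟨bK k, hbK k⟩ * v i ⟨aK k, haK k⟩ = 0) ∧
      f = fun q : ↥E × ↥E => ∑ i ∈ Finset.range p, u i q.1 * v i q.2}) :
    -- `𝒞` is a subalgebra:
    ((fun _ : ↥E × ↥E => (0 : ℝ)) ∈ 𝒞) ∧
    (∀ f ∈ 𝒞, ∀ g ∈ 𝒞, f + g ∈ 𝒞 ∧ f * g ∈ 𝒞) ∧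
    (∀ c : ℝ, ∀ f ∈ 𝒞, c • f ∈ 𝒞) ∧
    -- ... of `C_c(G)`:
    (∀ f ∈ 𝒞, Continuous f ∧ (∀ q ∉ G, f q = 0) ∧ HasCompactSupport f ∧
      ∀ ε : ℝ, 0 < ε →
        IsCompact {q : ↥E × ↥E | ε ≤ |f q|} ∧ {q : ↥E × ↥E | ε ≤ |f q|} ⊆ G) ∧
    -- separates the points of `G`:
    (∀ q₁ ∈ G, ∀ q₂ ∈ G, q₁ ≠ q₂ → ∃ f ∈ 𝒞, f q₁ ≠ f q₂) ∧
    -- vanishes at no point of `G`: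
    (∀ q ∈ G, ∃ f ∈ 𝒞, f q ≠ 0) ∧
    -- consequently, `𝒞` is dense in `C_c(G)` for the uniform norm:
    (∀ g : C(↥G, ℝ), HasCompactSupport ⇑g → ∀ ε : ℝ, 0 < ε →
      ∃ f ∈ 𝒞, ∀ q : ↥G, |f ↑q - g q| < ε) := by
  have : LocallyCompactSpace E :=
    locallyCompactSpace_of_isClosed_union_finite (Set.toFinite {l, r}) hclosed
  have hopen : IsOpen G := by
    rw [hG, hF]
    exact isOpen_offDiag_diff_gaps (fun x hx => hl ▸ sInf_le hx) (fun x hx => hr ▸ le_sSup hx)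
      haK hbK hlt hgaps
  have hadm (u v : C(E, ℝ)) : IsAdmissiblePair F u v ↔
      HasCompactSupport u ∧ HasCompactSupport v ∧ tsupport u ∩ tsupport v = ∅ ∧
        ∀ k : ι, u ⟨aK k, haK k⟩ * v ⟨bK k, hbK k⟩ = 0 ∧
          u ⟨bK k, hbK k⟩ * v ⟨aK k, haK k⟩ = 0 := by
    constructor
    · intro h
      refine ⟨h.compact_left, h.compact_right, h.disjoint, fun k => ⟨?_, ?_⟩⟩
      · exact h.eq_zero (⟨aK k, haK k⟩, ⟨bK k, hbK k⟩) (hF ▸ ⟨k, Or.inl ⟨rfl, rfl⟩⟩)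
      · exact h.eq_zero (⟨bK k, hbK k⟩, ⟨aK k, haK k⟩) (hF ▸ ⟨k, Or.inr ⟨rfl, rfl⟩⟩)
    · rintro ⟨hu, hv, hd, hk⟩
      refine ⟨hu, hv, hd, ?_⟩
      rw [hF]
      rintro ⟨⟨x, hx⟩, ⟨y, hy⟩⟩ ⟨k, ⟨rfl, rfl⟩ | ⟨rfl, rfl⟩⟩
      · exact (hk k).1
      · exact (hk k).2
  have h𝒞mem (f : E × E → ℝ) : f ∈ 𝒞 ↔ f ∈ disjointTensorSpan F := by
    simp only [h𝒞, mem_ofPred_eq, mem_disjointTensorSpan_iff, hadm]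
  clear h𝒞 hF hadm
  subst hG
  simp only [h𝒞mem]
  refine ⟨zero_mem _, fun f hf g hg => ⟨add_mem hf hg, mul_mem_disjointTensorSpan hf hg⟩,
    fun c f hf => smul_mem_disjointTensorSpan c hf, fun f hf => ?_, fun q₁ hq₁ q₂ hq₂ hne => ?_,
    fun q hq => ?_, fun g hg ε hε => exists_mem_disjointTensorSpan_near hopen subset_rfl g hg hε⟩
  · have hcont := continuous_of_mem_disjointTensorSpan hf
    have hcomp := hasCompactSupport_of_mem_disjointTensorSpan hf
    refine ⟨hcont, fun q => eq_zero_of_mem_disjointTensorSpan hf, hcomp, fun ε hε => ⟨?_, ?_⟩⟩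
    · refine hcomp.isCompact.of_isClosed_subset (isClosed_le continuous_const hcont.abs)
        fun q hq => subset_tsupport f fun h => ?_
      have hq' : ε ≤ |f q| := hq
      rw [h, abs_zero] at hq'
      exact hq'.not_gt hε
    · intro q hq
      by_contra hqG
      have hq' : ε ≤ |f q| := hq
      rw [eq_zero_of_mem_disjointTensorSpan hf hqG, abs_zero] at hq'
      exact hq'.not_gt hε
  · obtain ⟨f, hf, -, h₁, h₂⟩ := exists_mem_disjointTensorSpan_eq_one
      (hopen.inter (isOpen_compl_singleton (x := q₂))) inter_subset_left ⟨hq₁, hne⟩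
    refine ⟨f, hf, ?_⟩
    rw [h₁, h₂ q₂ fun h => h.2 rfl]
    exact one_ne_zero
  · obtain ⟨f, hf, -, h₁, -⟩ := exists_mem_disjointTensorSpan_eq_one hopen subset_rfl hq
    exact ⟨f, hf, h₁ ▸ one_ne_zero⟩
end
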